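/- arXiv:1312.6500 — 9 statements merged into one kernel-verified Lean document; each statement's English description precedes it below -/
import Mathlib

section
/- Let Q be a compact metric space and c : Q × Q → ℝ continuous. If (vₙ) is a sequence of c-concave functions on Q converging uniformly to a (necessarily c-concave) function v, then for every x ∈ Q one has min_{y ∈ ∂^c v(x)} c(x,y) ≤ liminf_{n→∞} ( min_{y ∈ ∂^c vₙ(x)} c(x,y) ). -/
open Filter Set

noncomputable section

/-- A function `v : Q → ℝ` is `c`-concave if there is an upper semicontinuous
`u : Q → ℝ` with `v x = ⨅ y, (c x y - u y)`. -/
def CConcave {Q : Type*} [TopologicalSpace Q] (c : Q → Q → ℝ) (v : Q → ℝ) : Prop :=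
  ∃ u : Q → ℝ, UpperSemicontinuous u ∧ ∀ x, v x = ⨅ y, (c x y - u y)

/-- The `c`-transform `v^c (y) = ⨅ x, (c x y - v x)`. -/
def ctransform {Q : Type*} (c : Q → Q → ℝ) (v : Q → ℝ) (y : Q) : ℝ :=
  ⨅ x, (c x y - v x)

/-- The `c`-superdifferential `∂^c v (x) = {y | v x + v^c y = c x y}`. -/
def csuperdiff {Q : Type*} (c : Q → Q → ℝ) (v : Q → ℝ) (x : Q) : Set Q :=
  {y | v x + ctransform c v y = c x y}

lemma bddBelow_range_sub_of_bddAbove {Q : Type*} {f g : Q → ℝ} (hf : ∀ x, 0 ≤ f x)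
    (hg : BddAbove (range g)) : BddBelow (range fun x => f x - g x) := by
  obtain ⟨M, hM⟩ := hg
  refine ⟨-M, ?_⟩
  rintro _ ⟨x, rfl⟩
  have h1 := hM (mem_range_self x)
  have h2 := hf x
  simp only
  linarith

lemma UpperSemicontinuous.bddAbove_range_of_compactSpace {Q : Type*} [TopologicalSpace Q]
    [CompactSpace Q] [Nonempty Q] {u : Q → ℝ} (hu : UpperSemicontinuous u) :
    BddAbove (range u) := by
  obtain ⟨a, -, ha⟩ := (hu.upperSemicontinuousOn univ).exists_isMaxOn univ_nonempty isCompact_univ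
  refine ⟨u a, ?_⟩
  rintro _ ⟨x, rfl⟩
  exact ha (mem_univ x)

lemma mem_csuperdiff_iff {Q : Type*} {c : Q → Q → ℝ} (hc0 : ∀ x y, 0 ≤ c x y) {v : Q → ℝ}
    (hv : BddAbove (range v)) {x y : Q} :
    y ∈ csuperdiff c v x ↔ ∀ x', c x y ≤ v x + (c x' y - v x') := by
  have : Nonempty Q := ⟨x⟩
  have hb : BddBelow (range fun x' => c x' y - v x') :=
    bddBelow_range_sub_of_bddAbove (fun x' => hc0 x' y) hv
  refine ⟨fun h x' => ?_, fun h => ?_⟩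
  · have h1 : ctransform c v y ≤ c x' y - v x' := ciInf_le hb x'
    have h2 : v x + ctransform c v y = c x y := h
    linarith
  · have h1 : ctransform c v y ≤ c x y - v x := ciInf_le hb x
    have h2 : c x y - v x ≤ ctransform c v y := le_ciInf fun x' => by linarith [h x']
    change v x + ctransform c v y = c x y
    linarith

section CConcave

variable {Q : Type*} [TopologicalSpace Q] [CompactSpace Q] {c : Q → Q → ℝ}

lemma CConcave.bddAbove_range [Nonempty Q] (hc : Continuous fun z : Q × Q => c z.1 z.2)
    (hc0 : ∀ x y, 0 ≤ c x y) {v : Q → ℝ} (hv : CConcave c v) : BddAbove (range v) := by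
  obtain ⟨u, hu, hvu⟩ := hv
  obtain ⟨y⟩ := ‹Nonempty Q›
  obtain ⟨C, hC⟩ := (isCompact_range (hc.comp (Continuous.prodMk_left y))).bddAbove
  refine ⟨C - u y, ?_⟩
  rintro _ ⟨x, rfl⟩
  have : Nonempty Q := ⟨x⟩
  have h1 : v x ≤ c x y - u y := hvu x ▸ ciInf_le
    (bddBelow_range_sub_of_bddAbove (hc0 x) hu.bddAbove_range_of_compactSpace) y
  have h2 : c x y ≤ C := hC (mem_range_self x)
  linarith

lemma CConcave.csuperdiff_nonempty (hc : Continuous fun z : Q × Q => c z.1 z.2)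
    (hc0 : ∀ x y, 0 ≤ c x y) {v : Q → ℝ} (hv : CConcave c v) (x : Q) :
    (csuperdiff c v x).Nonempty := by
  have : Nonempty Q := ⟨x⟩
  have hvb := hv.bddAbove_range hc hc0
  obtain ⟨u, hu, hvu⟩ := hv
  have hb (x' : Q) : BddBelow (range fun y => c x' y - u y) :=
    bddBelow_range_sub_of_bddAbove (hc0 x') hu.bddAbove_range_of_compactSpace
  have hcx : Continuous fun y => -c x y := (hc.comp (Continuous.prodMk_right x)).neg
  obtain ⟨y, -, hy⟩ := ((hu.add hcx.upperSemicontinuous).upperSemicontinuousOn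
    univ).exists_isMaxOn univ_nonempty isCompact_univ
  have hle : c x y - u y ≤ v x := by
    rw [hvu x]
    refine le_ciInf fun z => ?_
    have h : u z + -c x z ≤ u y + -c x y := hy (mem_univ z)
    linarith
  refine ⟨y, (mem_csuperdiff_iff hc0 hvb).2 fun x' => ?_⟩
  have h : v x' ≤ c x' y - u y := hvu x' ▸ ciInf_le (hb x') y
  linarith

end CConcave

lemma TendstoUniformly.bddAbove_range {ι Q : Type*} {l : Filter ι} [l.NeBot] {v : ι → Q → ℝ}
    {w : Q → ℝ} (h : TendstoUniformly v w l) (hv : ∀ n, BddAbove (range (v n))) :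
    BddAbove (range w) := by
  obtain ⟨n, hn⟩ := (Metric.tendstoUniformly_iff.1 h 1 one_pos).exists
  obtain ⟨M, hM⟩ := hv n
  refine ⟨M + 1, ?_⟩
  rintro _ ⟨x, rfl⟩
  have h1 := hM (mem_range_self x)
  have h2 := (abs_lt.1 (hn x)).2
  linarith

/-- If `c`-concave functions `vₙ` converge uniformly to `v`, then for every `x`,
`min_{y ∈ ∂^c v(x)} c(x,y) ≤ liminf_n min_{y ∈ ∂^c vₙ(x)} c(x,y)`. -/
theorem min_cost_superdiff_liminf
    {Q : Type*} [MetricSpace Q] [CompactSpace Q] [Nonempty Q]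
    (c : Q → Q → ℝ) (hc : Continuous fun z : Q × Q => c z.1 z.2)
    (hc0 : ∀ x y, 0 ≤ c x y) (hcd : ∀ x, c x x = 0)
    (v : ℕ → Q → ℝ) (w : Q → ℝ)
    (hcc : ∀ n, CConcave c (v n))
    (hconv : TendstoUniformly v w atTop) (x : Q) :
    sInf ((fun y => c x y) '' csuperdiff c w x) ≤
      Filter.liminf (fun n => sInf ((fun y => c x y) '' csuperdiff c (v n) x)) atTop := by
  have hvb n := (hcc n).bddAbove_range hc hc0
  have hne n := ((hcc n).csuperdiff_nonempty hc hc0 x).image (fun y => c x y)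
  have hbelow (s : Set Q) : BddBelow ((fun y => c x y) '' s) :=
    ⟨0, by rintro _ ⟨y, -, rfl⟩; exact hc0 x y⟩
  obtain ⟨C, hC⟩ := (isCompact_range (hc.comp (Continuous.prodMk_right x))).bddAbove
  have hcob : IsCoboundedUnder (· ≥ ·) atTop
      fun n => sInf ((fun y => c x y) '' csuperdiff c (v n) x) := by
    refine IsBoundedUnder.isCoboundedUnder_ge (isBoundedUnder_of ⟨C, fun n => ?_⟩)
    obtain ⟨y, hy⟩ := (hcc n).csuperdiff_nonempty hc hc0 x
    exact (csInf_le (hbelow _) (mem_image_of_mem _ hy)).trans (hC (mem_range_self y))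
  refine le_of_forall_lt_imp_le_of_dense fun b hb => le_liminf_of_le hcob ?_
  by_contra hfreq
  obtain ⟨φ, hφ, hlt⟩ := extraction_of_frequently_atTop (not_eventually.1 hfreq)
  have hex k : ∃ y ∈ csuperdiff c (v (φ k)) x, c x y < b := by
    obtain ⟨_, ⟨y, hy, rfl⟩, hyb⟩ := exists_lt_of_csInf_lt (hne (φ k)) (not_le.1 (hlt k))
    exact ⟨y, hy, hyb⟩
  choose y hy hyb using hex
  obtain ⟨z, ψ, hψ, hz⟩ := CompactSpace.tendsto_subseq y
  have hcz (x' : Q) : Tendsto (fun k => c x' (y (ψ k))) atTop (nhds (c x' z)) :=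
    ((hc.comp (Continuous.prodMk_right x')).tendsto z).comp hz
  have hvw (x' : Q) : Tendsto (fun k => v (φ (ψ k)) x') atTop (nhds (w x')) :=
    (hconv.tendsto_at x').comp (hφ.comp hψ).tendsto_atTop
  have hzmem : z ∈ csuperdiff c w x :=
    (mem_csuperdiff_iff hc0 (hconv.bddAbove_range hvb)).2 fun x' =>
      le_of_tendsto_of_tendsto' (hcz x) ((hvw x).add ((hcz x').sub (hvw x')))
        fun k => (mem_csuperdiff_iff hc0 (hvb _)).1 (hy (ψ k)) x'
  have hzb : c x z ≤ b := le_of_tendsto' (hcz x) fun k => (hyb (ψ k)).le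
  exact absurd hb (not_lt.2 ((csInf_le (hbelow _) (mem_image_of_mem _ hzmem)).trans hzb))
end
end

section
/- Let Q be a compact metric space, c : Q × Q → ℝ continuous, nonnegative with c(x,x) = 0, and p₀ : Q → [0,+∞] proper (not identically +∞). Set v₀(x) = inf_{y∈Q}(c(x,y) + p₀(y)). Then the class ℬ = { v : Q → ℝ : v is c-concave and 0 ≤ v(x) ≤ v₀(x) for all x ∈ Q } is a compact subset of C(Q) for the topology of uniform convergence. -/
open Filter Set
open scoped ENNReal

noncomputable section

section CConcave

variable {Q : Type*} [TopologicalSpace Q] [CompactSpace Q] {c : Q → Q → ℝ}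

/-- On a nonempty compact space, `c`-concavity means that the `c`-superdifferential is nonempty at
every point. -/
theorem cConcave_iff_forall_exists [Nonempty Q] (hc : Continuous fun z : Q × Q => c z.1 z.2)
    {v : Q → ℝ} (hv : Continuous v) :
    CConcave c v ↔ ∀ x, ∃ y, ∀ z, c x y + v z ≤ c z y + v x := by
  constructor
  · rintro ⟨u, hu, huv⟩
    have attained : ∀ x, ∃ y, ∀ z, c x y - u y ≤ c x z - u z := by
      intro x
      have hcx : Continuous fun y => -c x y := by fun_prop
      obtain ⟨y, -, hy⟩ := ((hu.add hcx.upperSemicontinuous).upperSemicontinuousOn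
        univ).exists_isMaxOn univ_nonempty isCompact_univ
      refine ⟨y, fun z => ?_⟩
      have := isMaxOn_iff.1 hy z (mem_univ z)
      linarith
    intro x
    obtain ⟨y, hy⟩ := attained x
    refine ⟨y, fun z => ?_⟩
    have h₁ : c x y - u y ≤ v x := huv x ▸ le_ciInf hy
    obtain ⟨w, hw⟩ := attained z
    have h₂ : v z ≤ c z y - u y := huv z ▸ ciInf_le ⟨c z w - u w, forall_mem_range.2 hw⟩ y
    linarith
  · intro h
    have bdd : ∀ y, BddBelow (range fun z => c z y - v z) := fun y =>
      (isCompact_range (by fun_prop : Continuous fun z => c z y - v z)).bddBelow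
    refine ⟨fun y => ⨅ z, (c z y - v z), upperSemicontinuous_ciInf bdd fun z =>
      (by fun_prop : Continuous fun y => c z y - v z).upperSemicontinuous, fun x => ?_⟩
    have lower : ∀ y, v x ≤ c x y - ⨅ z, (c z y - v z) := fun y => by
      have := ciInf_le (bdd y) x
      linarith
    obtain ⟨y, hy⟩ := h x
    refine le_antisymm (le_ciInf lower) ((ciInf_le ⟨v x, forall_mem_range.2 lower⟩ y).trans ?_)
    have : c x y - v x ≤ ⨅ z, (c z y - v z) := le_ciInf fun z => by linarith [hy z]
    linarith

theorem isClosed_setOf_forall_exists_superdifferential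
    (hc : Continuous fun z : Q × Q => c z.1 z.2) :
    IsClosed {f : Q → ℝ | ∀ x, ∃ y, ∀ z, c x y + f z ≤ c z y + f x} := by
  rw [ofPred_forall]
  refine isClosed_iInter fun x => ?_
  have hcl : IsClosed {p : Q × (Q → ℝ) | ∀ z, c x p.1 + p.2 z ≤ c z p.1 + p.2 x} := by
    rw [ofPred_forall]
    have hcw : ∀ w, Continuous fun p : Q × (Q → ℝ) => c w p.1 := fun w =>
      hc.comp (continuous_const.prodMk continuous_fst)
    have hev : ∀ w, Continuous fun p : Q × (Q → ℝ) => p.2 w := fun w =>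
      (continuous_apply w).comp continuous_snd
    exact isClosed_iInter fun z => isClosed_le ((hcw x).add (hev z)) ((hcw z).add (hev x))
  convert isClosedMap_snd_of_compactSpace _ hcl using 1
  ext f
  simp

theorem equicontinuous_of_forall_exists_superdifferential {ι : Type*}
    (hc : Continuous fun z : Q × Q => c z.1 z.2) {F : ι → Q → ℝ}
    (hF : ∀ i x, ∃ y, ∀ z, c x y + F i z ≤ c z y + F i x) : Equicontinuous F := by
  let C : C(Q, C(Q, ℝ)) := ContinuousMap.curry ⟨fun z : Q × Q => c z.1 z.2, hc⟩
  have le_add : ∀ i x z, F i z ≤ F i x + dist (C x) (C z) := by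
    intro i x z
    obtain ⟨y, hy⟩ := hF i x
    have h : |c x y - c z y| ≤ dist (C x) (C z) :=
      ContinuousMap.dist_apply_le_dist (f := C x) (g := C z) y
    have := neg_le_of_abs_le h
    linarith [hy z]
  intro x₀
  refine Metric.equicontinuousAt_of_continuity_modulus (fun x => dist (C x₀) (C x)) ?_ F
    (Eventually.of_forall fun x i => ?_)
  · have : Continuous fun x => dist (C x₀) (C x) := continuous_const.dist C.continuous
    simpa using this.tendsto x₀
  · rw [Real.dist_eq, abs_sub_le_iff]
    have h₁ := le_add i x₀ x
    have h₂ := le_add i x x₀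
    rw [dist_comm] at h₂
    constructor <;> linarith

end CConcave

/-- The class `ℬ = { v c-concave : 0 ≤ v ≤ v₀ }`, where
`v₀(x) = inf_y (c x y + p₀ y)`, is compact in `C(Q, ℝ)` for the topology of
uniform convergence. -/
theorem class_B_isCompact
    {Q : Type*} [MetricSpace Q] [CompactSpace Q] [Nonempty Q]
    (c : Q → Q → ℝ) (hc : Continuous fun z : Q × Q => c z.1 z.2)
    (hc0 : ∀ x y, 0 ≤ c x y) (hcd : ∀ x, c x x = 0)
    (p₀ : Q → ℝ≥0∞) (hp₀ : ∃ y, p₀ y ≠ ⊤)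
    (v₀ : Q → ℝ)
    (hv₀ : ∀ x, v₀ x = (⨅ y, ((c x y : EReal) + (p₀ y : EReal))).toReal) :
    IsCompact {v : C(Q, ℝ) | CConcave c ⇑v ∧ ∀ x, 0 ≤ v x ∧ v x ≤ v₀ x} := by
  have hmem : ∀ v : C(Q, ℝ), (CConcave c ⇑v ∧ ∀ x, 0 ≤ v x ∧ v x ≤ v₀ x) ↔
      (⇑v ∈ {f : Q → ℝ | ∀ x, ∃ y, ∀ z, c x y + f z ≤ c z y + f x} ∩
        univ.pi fun x => Icc 0 (v₀ x)) := fun v => by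
    simp only [cConcave_iff_forall_exists hc v.continuous, mem_inter_iff, mem_ofPred_eq, mem_univ_pi,
      mem_Icc]
  refine ArzelaAscoli.isCompact_of_equicontinuous _ ?_
    (equicontinuous_of_forall_exists_superdifferential hc fun v => ((hmem v).1 v.2).1)
  convert (isCompact_univ_pi fun x => isCompact_Icc (a := 0) (b := v₀ x)).inter_left
    (isClosed_setOf_forall_exists_superdifferential hc) using 1
  ext f
  constructor
  · rintro ⟨v, hv, rfl⟩
    exact (hmem v).1 hv
  · intro hf
    have hcont : Continuous f :=
      (equicontinuous_of_forall_exists_superdifferential hc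
        (F := fun _ : Unit => f) fun _ => hf.1).continuous ()
    exact ⟨⟨f, hcont⟩, (hmem ⟨f, hcont⟩).2 hf, rfl⟩
end
end

section
/- Let Q be a compact metric space, c : Q × Q → ℝ continuous, nonnegative with c(x,x) = 0, p₀ : Q → [0,+∞] proper, and f a finite nonnegative Borel measure on Q. If v* maximizes I over ℬ = { v c-concave : 0 ≤ v ≤ v₀ }, then p* := −(v*)^c belongs to the admissible class 𝒜 and maximizes the profit F over 𝒜: for every p ∈ 𝒜, F(p) ≤ F(p*). In particular the optimal pricing problem max{ F(p) : p ∈ 𝒜 } admits a solution. -/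
open Filter Set MeasureTheory
open scoped ENNReal

noncomputable section

/-- The profit functional `I(v) = ∫ (v x - min_{y ∈ ∂^c v(x)} c x y) df`. -/
def Ifun {Q : Type*} [MeasurableSpace Q] (f : Measure Q) (c : Q → Q → ℝ)
    (v : Q → ℝ) : ℝ :=
  ∫ x, (v x - sInf ((fun y => c x y) '' csuperdiff c v x)) ∂f

/-- The minimal total expenditure `v_p(x) = min_y (c x y + p y)` for an extended
real valued price `p`. -/
def vpE {Q : Type*} (c : Q → Q → ℝ) (p : Q → EReal) (x : Q) : EReal :=
  ⨅ y, ((c x y : EReal) + p y)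

/-- The set `T_p(x)` of optimal shopping locations for a customer living at `x`. -/
def TpE {Q : Type*} (c : Q → Q → ℝ) (p : Q → EReal) (x : Q) : Set Q :=
  {y | (c x y : EReal) + p y = vpE c p x}

/-- The total income `F(p) = ∫ (max_{y ∈ T_p(x)} p y) df(x)` of the agent. -/
def Fincome {Q : Type*} [MeasurableSpace Q] (f : Measure Q) (c : Q → Q → ℝ)
    (p : Q → EReal) : ℝ :=
  ∫ x, (sSup (p '' TpE c p x)).toReal ∂f

section CTransform

variable {Q : Type*} {c : Q → Q → ℝ} {v : Q → ℝ}

lemma bddBelow_range_cost_sub (hc0 : ∀ x y, 0 ≤ c x y) (hv : BddAbove (range v)) (y : Q) :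
    BddBelow (range fun x => c x y - v x) := by
  obtain ⟨B, hB⟩ := hv
  refine ⟨-B, ?_⟩
  rintro _ ⟨x, rfl⟩
  have := hB (mem_range_self x)
  have := hc0 x y
  dsimp only
  linarith

lemma bddBelow_range_cost_sub' (hc0 : ∀ x y, 0 ≤ c x y) (hv : BddAbove (range v)) (x : Q) :
    BddBelow (range fun y => c x y - v y) :=
  bddBelow_range_cost_sub (c := fun y x => c x y) (fun x y => hc0 y x) hv x

lemma add_ctransform_le (hc0 : ∀ x y, 0 ≤ c x y) (hv : BddAbove (range v)) (x y : Q) :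
    v x + ctransform c v y ≤ c x y := by
  have := ciInf_le (bddBelow_range_cost_sub hc0 hv y) x
  unfold ctransform
  linarith

lemma mem_csuperdiff_iff_le (hc0 : ∀ x y, 0 ≤ c x y) (hv : BddAbove (range v)) {x y : Q} :
    y ∈ csuperdiff c v x ↔ c x y ≤ v x + ctransform c v y :=
  ⟨fun h => h.ge, fun h => (add_ctransform_le hc0 hv x y).antisymm h⟩

lemma ctransform_nonpos (hc0 : ∀ x y, 0 ≤ c x y) (hcd : ∀ x, c x x = 0)
    (hv : BddAbove (range v)) (hv0 : ∀ x, 0 ≤ v x) (y : Q) : ctransform c v y ≤ 0 := by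
  have := add_ctransform_le hc0 hv y y
  have := hv0 y
  have := hcd y
  linarith

lemma cost_le_of_mem_csuperdiff (hc0 : ∀ x y, 0 ≤ c x y) (hcd : ∀ x, c x x = 0)
    (hv : BddAbove (range v)) (hv0 : ∀ x, 0 ≤ v x) {x y : Q} (hy : y ∈ csuperdiff c v x) :
    c x y ≤ v x := by
  have := ctransform_nonpos hc0 hcd hv hv0 y
  have := (mem_csuperdiff_iff_le hc0 hv).1 hy
  linarith

lemma sInf_cost_csuperdiff_nonneg (hc0 : ∀ x y, 0 ≤ c x y) (x : Q) :
    0 ≤ sInf ((fun y => c x y) '' csuperdiff c v x) := by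
  apply Real.sInf_nonneg
  rintro _ ⟨y, -, rfl⟩
  exact hc0 x y

lemma sInf_cost_csuperdiff_le (hc0 : ∀ x y, 0 ≤ c x y) {x y : Q}
    (hy : y ∈ csuperdiff c v x) :
    sInf ((fun y => c x y) '' csuperdiff c v x) ≤ c x y := by
  refine csInf_le ⟨0, ?_⟩ ⟨y, hy, rfl⟩
  rintro _ ⟨y, -, rfl⟩
  exact hc0 x y

lemma sInf_cost_csuperdiff_le_self (hc0 : ∀ x y, 0 ≤ c x y) (hcd : ∀ x, c x x = 0)
    (hv : BddAbove (range v)) (hv0 : ∀ x, 0 ≤ v x) (x : Q) :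
    sInf ((fun y => c x y) '' csuperdiff c v x) ≤ v x := by
  rcases (csuperdiff c v x).eq_empty_or_nonempty with h | ⟨y, hy⟩
  · simpa [h] using hv0 x
  · exact (sInf_cost_csuperdiff_le hc0 hy).trans (cost_le_of_mem_csuperdiff hc0 hcd hv hv0 hy)

end CTransform

section Semicontinuity

variable {Q : Type*} [TopologicalSpace Q] {c : Q → Q → ℝ} {v : Q → ℝ}

lemma upperSemicontinuous_ctransform (hc : Continuous fun z : Q × Q => c z.1 z.2)
    (hc0 : ∀ x y, 0 ≤ c x y) (hv : BddAbove (range v)) :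
    UpperSemicontinuous (ctransform c v) := by
  refine upperSemicontinuous_ciInf (f := fun x y => c x y - v x)
    (bddBelow_range_cost_sub hc0 hv) fun x => Continuous.upperSemicontinuous ?_
  exact (hc.comp (by fun_prop : Continuous fun y : Q => (x, y))).sub continuous_const

lemma UpperSemicontinuous.bddAbove_range_of_compactSpace_s5 [CompactSpace Q]
    (hv : UpperSemicontinuous v) : BddAbove (range v) := by
  have := (hv.upperSemicontinuousOn univ).bddAbove_of_isCompact isCompact_univ
  rwa [image_univ] at this

lemma CConcave.upperSemicontinuous [CompactSpace Q]
    (hc : Continuous fun z : Q × Q => c z.1 z.2) (hc0 : ∀ x y, 0 ≤ c x y)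
    (hv : CConcave c v) : UpperSemicontinuous v := by
  obtain ⟨u, hu, huv⟩ := hv
  have : v = ctransform (fun y x => c x y) u := funext huv
  rw [this]
  exact upperSemicontinuous_ctransform (hc.comp continuous_swap) (fun x y => hc0 y x)
    hu.bddAbove_range_of_compactSpace_s5

lemma CConcave.bddAbove [CompactSpace Q]
    (hc : Continuous fun z : Q × Q => c z.1 z.2) (hc0 : ∀ x y, 0 ≤ c x y)
    (hv : CConcave c v) : BddAbove (range v) :=
  (hv.upperSemicontinuous hc hc0).bddAbove_range_of_compactSpace_s5

/-- The graph of the `c`-superdifferential of a `c`-concave function is closed. -/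
lemma CConcave.isClosed_graph [CompactSpace Q]
    (hc : Continuous fun z : Q × Q => c z.1 z.2) (hc0 : ∀ x y, 0 ≤ c x y)
    (hv : CConcave c v) : IsClosed {z : Q × Q | z.2 ∈ csuperdiff c v z.1} := by
  have hb := hv.bddAbove hc hc0
  have h1 : UpperSemicontinuous fun z : Q × Q => v z.1 + ctransform c v z.2 + -c z.1 z.2 :=
    (((hv.upperSemicontinuous hc hc0).comp continuous_fst).add
      ((upperSemicontinuous_ctransform hc hc0 hb).comp continuous_snd)).add
      hc.neg.upperSemicontinuous
  convert h1.isClosed_preimage 0 using 1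
  ext z
  simp only [mem_ofPred_eq, mem_csuperdiff_iff_le hc0 hb, mem_preimage, mem_Ici]
  constructor <;> intro h <;> linarith

lemma CConcave.isCompact_csuperdiff [CompactSpace Q]
    (hc : Continuous fun z : Q × Q => c z.1 z.2) (hc0 : ∀ x y, 0 ≤ c x y)
    (hv : CConcave c v) (x : Q) : IsCompact (csuperdiff c v x) :=
  ((hv.isClosed_graph hc hc0).preimage (by fun_prop : Continuous fun y : Q => (x, y))).isCompact

lemma CConcave.nonempty_csuperdiff [CompactSpace Q] [Nonempty Q]
    (hc : Continuous fun z : Q × Q => c z.1 z.2) (hc0 : ∀ x y, 0 ≤ c x y)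
    (hv : CConcave c v) (x : Q) : (csuperdiff c v x).Nonempty := by
  have hb := hv.bddAbove hc hc0
  have h1 : UpperSemicontinuous fun y : Q => ctransform c v y + -c x y :=
    (upperSemicontinuous_ctransform hc hc0 hb).add
      (hc.comp (by fun_prop : Continuous fun y : Q => (x, y))).neg.upperSemicontinuous
  obtain ⟨y, -, hy⟩ := (h1.upperSemicontinuousOn univ).exists_isMaxOn univ_nonempty isCompact_univ
  obtain ⟨u, hu, huv⟩ := hv
  refine ⟨y, (mem_csuperdiff_iff_le hc0 hb).2 ?_⟩
  have hub := bddBelow_range_cost_sub' hc0 hu.bddAbove_range_of_compactSpace_s5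
  have key : c x y - ctransform c v y ≤ v x := by
    rw [huv x]
    refine le_ciInf fun z => ?_
    have hz : u z ≤ ctransform c v z := by
      refine le_ciInf fun t => ?_
      have := ciInf_le (hub t) z
      rw [← huv t] at this
      linarith
    have : ctransform c v z + -c x z ≤ ctransform c v y + -c x y := hy (mem_univ z)
    linarith
  linarith

lemma CConcave.exists_isLeast_cost [CompactSpace Q] [Nonempty Q]
    (hc : Continuous fun z : Q × Q => c z.1 z.2) (hc0 : ∀ x y, 0 ≤ c x y)
    (hv : CConcave c v) (x : Q) :
    ∃ y ∈ csuperdiff c v x, IsLeast ((fun y => c x y) '' csuperdiff c v x) (c x y) := by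
  have hcx : Continuous fun y => c x y := hc.comp (by fun_prop : Continuous fun y : Q => (x, y))
  obtain ⟨_, hm⟩ := ((hv.isCompact_csuperdiff hc hc0 x).image hcx).exists_isLeast
    ((hv.nonempty_csuperdiff hc hc0 x).image _)
  obtain ⟨y, hy, rfl⟩ := hm.1
  exact ⟨y, hy, hm⟩

/-- A function lying above the double `c`-transform built from its own `c`-transform
is `c`-concave. -/
lemma cconcave_of_iInf_le [Nonempty Q] (hc : Continuous fun z : Q × Q => c z.1 z.2)
    (hc0 : ∀ x y, 0 ≤ c x y) (hb : BddAbove (range v))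
    (h : ∀ x, (⨅ y, (c x y - ctransform c v y)) ≤ v x) : CConcave c v := by
  refine ⟨ctransform c v, upperSemicontinuous_ctransform hc hc0 hb, fun x => le_antisymm ?_ (h x)⟩
  refine le_ciInf fun y => ?_
  have := add_ctransform_le hc0 hb x y
  linarith

lemma CConcave.measurable_sInf_cost [CompactSpace Q] [Nonempty Q]
    [MeasurableSpace Q] [BorelSpace Q]
    (hc : Continuous fun z : Q × Q => c z.1 z.2) (hc0 : ∀ x y, 0 ≤ c x y)
    (hv : CConcave c v) :
    Measurable fun x => sInf ((fun y => c x y) '' csuperdiff c v x) := by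
  refine measurable_of_Iic fun t => IsClosed.measurableSet ?_
  have hcl : IsClosed ({z : Q × Q | z.2 ∈ csuperdiff c v z.1} ∩ {z | c z.1 z.2 ≤ t}) :=
    (hv.isClosed_graph hc hc0).inter (isClosed_le hc continuous_const)
  convert isClosedMap_fst_of_compactSpace _ hcl using 1
  ext x
  simp only [mem_preimage, mem_Iic, mem_image, mem_inter_iff, mem_ofPred_eq, Prod.exists,
    exists_and_right, exists_eq_right]
  constructor
  · intro h
    obtain ⟨y, hy, hm⟩ := hv.exists_isLeast_cost hc hc0 x
    exact ⟨y, hy, hm.csInf_eq ▸ h⟩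
  · rintro ⟨y, hy, hyt⟩
    exact (sInf_cost_csuperdiff_le hc0 hy).trans hyt

lemma CConcave.integrable_profit [CompactSpace Q] [Nonempty Q]
    [MeasurableSpace Q] [BorelSpace Q]
    (hc : Continuous fun z : Q × Q => c z.1 z.2) (hc0 : ∀ x y, 0 ≤ c x y)
    (hcd : ∀ x, c x x = 0) (f : Measure Q) [IsFiniteMeasure f]
    (hv : CConcave c v) (hv0 : ∀ x, 0 ≤ v x) :
    Integrable (fun x => v x - sInf ((fun y => c x y) '' csuperdiff c v x)) f := by
  have hb := hv.bddAbove hc hc0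
  obtain ⟨B, hB⟩ := id hb
  refine Integrable.of_bound (C := B) (((hv.upperSemicontinuous hc hc0).measurable.sub
    (hv.measurable_sInf_cost hc hc0)).aestronglyMeasurable) (ae_of_all _ fun x => ?_)
  have h1 := sInf_cost_csuperdiff_nonneg (v := v) hc0 x
  have h2 := sInf_cost_csuperdiff_le_self hc0 hcd hb hv0 x
  have h3 := hB (mem_range_self x)
  rw [Real.norm_eq_abs, abs_of_nonneg (by linarith)]
  linarith

end Semicontinuity

section Price

variable {Q : Type*} {c : Q → Q → ℝ}

lemma vpE_nonneg (hc0 : ∀ x y, 0 ≤ c x y) {q : Q → EReal} (hq : ∀ y, 0 ≤ q y) (x : Q) :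
    0 ≤ vpE c q x :=
  le_iInf fun y => add_nonneg (EReal.coe_nonneg.2 (hc0 x y)) (hq y)

lemma coe_toReal_vpE (hc0 : ∀ x y, 0 ≤ c x y) {q : Q → EReal} (hq : ∀ y, 0 ≤ q y)
    (hqt : ∃ y, q y ≠ ⊤) (x : Q) : ((vpE c q x).toReal : EReal) = vpE c q x := by
  refine EReal.coe_toReal ?_ (ne_of_gt ((EReal.bot_lt_zero).trans_le (vpE_nonneg hc0 hq x)))
  obtain ⟨y, hy⟩ := hqt
  exact ((iInf_le _ y).trans_lt (EReal.add_lt_top (EReal.coe_ne_top _) hy)).ne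

lemma toReal_vpE_le (hc0 : ∀ x y, 0 ≤ c x y) {q : Q → EReal} (hq : ∀ y, 0 ≤ q y)
    {y : Q} {r : ℝ} (hr : q y = r) (x : Q) : (vpE c q x).toReal ≤ c x y + r := by
  rw [← EReal.coe_le_coe_iff, coe_toReal_vpE hc0 hq ⟨y, hr ▸ EReal.coe_ne_top r⟩, EReal.coe_add,
    ← hr]
  exact iInf_le _ y

lemma bddAbove_toReal_vpE [TopologicalSpace Q] [CompactSpace Q]
    (hc : Continuous fun z : Q × Q => c z.1 z.2)
    (hc0 : ∀ x y, 0 ≤ c x y) {q : Q → EReal} (hq : ∀ y, 0 ≤ q y)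
    (hqt : ∃ y, q y ≠ ⊤) : BddAbove (range fun x => (vpE c q x).toReal) := by
  obtain ⟨y, hy⟩ := hqt
  have hr : q y = ((q y).toReal : EReal) :=
    (EReal.coe_toReal hy (ne_of_gt (EReal.bot_lt_zero.trans_le (hq y)))).symm
  have hcy : Continuous fun x => c x y + (q y).toReal :=
    (hc.comp (by fun_prop : Continuous fun x : Q => (x, y))).add continuous_const
  obtain ⟨B, hB⟩ := (isCompact_range hcy).bddAbove
  refine ⟨B, ?_⟩
  rintro _ ⟨x, rfl⟩
  exact (toReal_vpE_le hc0 hq hr x).trans (hB ⟨x, rfl⟩)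

lemma neg_le_ctransform_toReal_vpE [Nonempty Q] (hc0 : ∀ x y, 0 ≤ c x y) {q : Q → EReal}
    (hq : ∀ y, 0 ≤ q y) {y : Q} {r : ℝ} (hr : q y = r) :
    -r ≤ ctransform c (fun x => (vpE c q x).toReal) y := by
  refine le_ciInf fun x => ?_
  have := toReal_vpE_le hc0 hq hr x
  linarith

lemma cconcave_toReal_vpE [TopologicalSpace Q] [CompactSpace Q] [Nonempty Q]
    (hc : Continuous fun z : Q × Q => c z.1 z.2)
    (hc0 : ∀ x y, 0 ≤ c x y) {q : Q → EReal} (hq : ∀ y, 0 ≤ q y)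
    (hqt : ∃ y, q y ≠ ⊤) : CConcave c fun x => (vpE c q x).toReal := by
  have hb := bddAbove_toReal_vpE hc hc0 hq hqt
  refine cconcave_of_iInf_le hc hc0 hb fun x => ?_
  rw [← EReal.coe_le_coe_iff, coe_toReal_vpE hc0 hq hqt]
  refine le_iInf fun y => ?_
  rcases eq_or_ne (q y) ⊤ with h | h
  · rw [h, EReal.coe_add_top]
    exact le_top
  have hr : q y = ((q y).toReal : EReal) :=
    (EReal.coe_toReal h (ne_of_gt (EReal.bot_lt_zero.trans_le (hq y)))).symm
  rw [hr, ← EReal.coe_add, EReal.coe_le_coe_iff]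
  have hbb := (upperSemicontinuous_ctransform hc hc0 hb).bddAbove_range_of_compactSpace_s5
  refine (ciInf_le (bddBelow_range_cost_sub' hc0 hbb x) y).trans ?_
  have := neg_le_ctransform_toReal_vpE hc0 hq hr
  linarith

/-- Truncating a price at zero and passing to the associated `c`-concave function does not
decrease the pointwise income. -/
lemma toReal_sSup_image_TpE_le [TopologicalSpace Q] [CompactSpace Q] [Nonempty Q]
    (hc : Continuous fun z : Q × Q => c z.1 z.2)
    (hc0 : ∀ x y, 0 ≤ c x y) (hcd : ∀ x, c x x = 0) {p : Q → EReal} (hpt : ∃ y, p y ≠ ⊤)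
    {v : Q → ℝ} (hv : v = fun x => (vpE c (fun y => max (p y) 0) x).toReal) (x : Q) :
    (sSup (p '' TpE c p x)).toReal ≤
      v x - sInf ((fun y => c x y) '' csuperdiff c v x) := by
  have hq : ∀ y, 0 ≤ max (p y) 0 := fun y => le_max_right _ _
  have hqt : ∃ y, max (p y) 0 ≠ ⊤ := by
    obtain ⟨y, hy⟩ := hpt
    exact ⟨y, (max_lt hy.lt_top EReal.zero_lt_top).ne⟩
  have hb : BddAbove (range v) := hv ▸ bddAbove_toReal_vpE hc hc0 hq hqt
  have hcoe : (v x : EReal) = vpE c (fun y => max (p y) 0) x := by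
    rw [hv]; exact coe_toReal_vpE hc0 hq hqt x
  have hv0 : ∀ x, 0 ≤ v x := fun x => by
    rw [hv]; exact EReal.toReal_nonneg (vpE_nonneg hc0 hq x)
  have hR := sub_nonneg.2 (sInf_cost_csuperdiff_le_self hc0 hcd hb hv0 x)
  set R := v x - sInf ((fun y => c x y) '' csuperdiff c v x) with hRdef
  have hle : sSup (p '' TpE c p x) ≤ (R : EReal) := by
    refine sSup_le ?_
    rintro _ ⟨y, hy, rfl⟩
    rcases le_or_gt (p y) 0 with h | h
    · exact h.trans (EReal.coe_nonneg.2 hR)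
    have hpy : max (p y) 0 = p y := max_eq_left h.le
    have hmono : vpE c p x ≤ vpE c (fun y => max (p y) 0) x :=
      iInf_mono fun z => add_le_add le_rfl (le_max_left _ _)
    have hle' : (c x y : EReal) + p y ≤ (v x : EReal) := by
      rw [hcoe]
      exact hy.le.trans hmono
    have htop : p y ≠ ⊤ := by
      intro ht
      rw [ht, EReal.coe_add_top] at hle'
      exact absurd hle' (EReal.coe_lt_top _).not_ge
    have hr : p y = ((p y).toReal : EReal) :=
      (EReal.coe_toReal htop (ne_of_gt (EReal.bot_lt_zero.trans h))).symm
    rw [hr, ← EReal.coe_add, EReal.coe_le_coe_iff] at hle'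
    have hct : -(p y).toReal ≤ ctransform c v y := by
      rw [hv]
      exact neg_le_ctransform_toReal_vpE hc0 hq (hpy.trans hr)
    have hmem : y ∈ csuperdiff c v x := (mem_csuperdiff_iff_le hc0 hb).2 (by linarith)
    have := sInf_cost_csuperdiff_le hc0 hmem
    rw [hr, EReal.coe_le_coe_iff]
    linarith
  rcases eq_or_ne (sSup (p '' TpE c p x)) ⊥ with h | h
  · rwa [h, EReal.toReal_bot]
  · exact EReal.toReal_le_toReal hle h (EReal.coe_ne_top _)

/-- The price `-v^c` of a `c`-concave function `v` yields the pointwise income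
appearing in `Ifun`. -/
lemma toReal_sSup_image_TpE_neg_ctransform [TopologicalSpace Q] [CompactSpace Q] [Nonempty Q]
    (hc : Continuous fun z : Q × Q => c z.1 z.2) (hc0 : ∀ x y, 0 ≤ c x y)
    {v : Q → ℝ} (hv : CConcave c v) {p : Q → EReal}
    (hp : ∀ y, p y = ((-(ctransform c v y) : ℝ) : EReal)) (x : Q) :
    (sSup (p '' TpE c p x)).toReal = v x - sInf ((fun y => c x y) '' csuperdiff c v x) := by
  have hb := hv.bddAbove hc hc0
  obtain ⟨y, hy, hm⟩ := hv.exists_isLeast_cost hc hc0 x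
  have hval : vpE c p x = (v x : EReal) := by
    apply le_antisymm
    · refine (iInf_le _ y).trans ?_
      rw [hp, ← EReal.coe_add, EReal.coe_le_coe_iff]
      have := (mem_csuperdiff_iff_le hc0 hb).1 hy
      linarith
    · refine le_iInf fun z => ?_
      rw [hp, ← EReal.coe_add, EReal.coe_le_coe_iff]
      have := add_ctransform_le hc0 hb x z
      linarith
  have hT : TpE c p x = csuperdiff c v x := by
    ext z
    simp only [TpE, csuperdiff, mem_ofPred_eq, hval, hp]
    rw [← EReal.coe_add, EReal.coe_eq_coe_iff]
    constructor <;> intro h <;> linarith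
  have hg : IsGreatest (p '' TpE c p x) ((v x - c x y : ℝ) : EReal) := by
    have hpz : ∀ z ∈ csuperdiff c v x, p z = ((v x - c x z : ℝ) : EReal) := by
      intro z hz
      have hz : v x + ctransform c v z = c x z := hz
      rw [hp, EReal.coe_eq_coe_iff]
      linarith
    rw [hT]
    refine ⟨⟨y, hy, hpz y hy⟩, ?_⟩
    rintro _ ⟨z, hz, rfl⟩
    rw [hpz z hz, EReal.coe_le_coe_iff]
    have : c x y ≤ c x z := hm.2 ⟨z, hz, rfl⟩
    linarith
  rw [hg.csSup_eq, hm.csInf_eq, EReal.toReal_coe]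

lemma neg_ctransform_le_price [Nonempty Q] (hc0 : ∀ x y, 0 ≤ c x y) {p₀ : Q → ℝ≥0∞}
    {v : Q → ℝ} (hv : ∀ x, v x ≤ (vpE c (fun y => (p₀ y : EReal)) x).toReal) (y : Q) :
    ((-(ctransform c v y) : ℝ) : EReal) ≤ (p₀ y : EReal) := by
  rcases eq_or_ne (p₀ y) ⊤ with h | h
  · simp [h]
  have hr : (p₀ y : EReal) = ((p₀ y).toReal : EReal) := (EReal.coe_ennreal_toReal h).symm
  rw [hr, EReal.coe_le_coe_iff, neg_le]
  refine le_ciInf fun x => ?_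
  have := toReal_vpE_le hc0 (fun y => EReal.coe_ennreal_nonneg (p₀ y)) hr x
  have := hv x
  linarith

end Price

/-- If `v*` maximizes `I` over `ℬ`, then `p* := -(v*)^c` is admissible and
maximizes the profit `F` over the admissible class `𝒜`; in particular the
optimal pricing problem admits a solution. -/
theorem optimal_price_from_maximizer
    {Q : Type*} [MetricSpace Q] [CompactSpace Q] [Nonempty Q]
    [MeasurableSpace Q] [BorelSpace Q]
    (c : Q → Q → ℝ) (hc : Continuous fun z : Q × Q => c z.1 z.2)
    (hc0 : ∀ x y, 0 ≤ c x y) (hcd : ∀ x, c x x = 0)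
    (p₀ : Q → ℝ≥0∞) (hp₀ : ∃ y, p₀ y ≠ ⊤)
    (f : Measure Q) [IsFiniteMeasure f]
    (v₀ : Q → ℝ)
    (hv₀ : ∀ x, v₀ x = (⨅ y, ((c x y : EReal) + (p₀ y : EReal))).toReal)
    (vstar : Q → ℝ) (hvs : CConcave c vstar)
    (hvsb : ∀ x, 0 ≤ vstar x ∧ vstar x ≤ v₀ x)
    (hmax : ∀ v : Q → ℝ, CConcave c v → (∀ x, 0 ≤ v x ∧ v x ≤ v₀ x) →
      Ifun f c v ≤ Ifun f c vstar)
    (pstar : Q → EReal) (hpstar : ∀ y, pstar y = ((-(ctransform c vstar y) : ℝ) : EReal)) :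
    (LowerSemicontinuous pstar ∧ (∃ y, pstar y ≠ ⊤) ∧ ∀ y, pstar y ≤ (p₀ y : EReal)) ∧
      ∀ p : Q → EReal, LowerSemicontinuous p → (∀ y, p y ≠ ⊥) → (∃ y, p y ≠ ⊤) →
        (∀ y, p y ≤ (p₀ y : EReal)) → Fincome f c p ≤ Fincome f c pstar := by
  have hvb := hvs.bddAbove hc hc0
  have hI : Fincome f c pstar = Ifun f c vstar := by
    unfold Fincome Ifun
    simp only [toReal_sSup_image_TpE_neg_ctransform hc hc0 hvs hpstar]
  refine ⟨⟨?_, ?_, ?_⟩, ?_⟩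
  · have : pstar = (fun t : ℝ => ((-t : ℝ) : EReal)) ∘ ctransform c vstar := funext hpstar
    rw [this]
    refine (continuous_coe_real_ereal.comp continuous_neg).comp_upperSemicontinuous_antitone
      (upperSemicontinuous_ctransform hc hc0 hvb) fun a b hab => ?_
    simpa using hab
  · obtain ⟨y⟩ := ‹Nonempty Q›
    exact ⟨y, by rw [hpstar]; exact EReal.coe_ne_top _⟩
  · intro y
    rw [hpstar]
    exact neg_ctransform_le_price hc0 (fun x => (hvsb x).2.trans (hv₀ x).le) y
  intro p _ _ hpt hpp
  rw [hI]
  have hq : ∀ y, 0 ≤ max (p y) 0 := fun y => le_max_right _ _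
  have hqt : ∃ y, max (p y) 0 ≠ ⊤ := by
    obtain ⟨y, hy⟩ := hpt
    exact ⟨y, (max_lt hy.lt_top EReal.zero_lt_top).ne⟩
  obtain ⟨v, hv⟩ : ∃ v : Q → ℝ, v = fun x => (vpE c (fun y => max (p y) 0) x).toReal := ⟨_, rfl⟩
  have hvc : CConcave c v := hv ▸ cconcave_toReal_vpE hc hc0 hq hqt
  have hv0 : ∀ x, 0 ≤ v x := fun x => by
    rw [hv]; exact EReal.toReal_nonneg (vpE_nonneg hc0 hq x)
  have hvv₀ : ∀ x, v x ≤ v₀ x := fun x => by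
    have h0t : ∃ y, (p₀ y : EReal) ≠ ⊤ := by simpa using hp₀
    rw [← EReal.coe_le_coe_iff, hv, hv₀, coe_toReal_vpE hc0 hq hqt]
    refine le_of_le_of_eq ?_
      (coe_toReal_vpE hc0 (fun y => EReal.coe_ennreal_nonneg (p₀ y)) h0t x).symm
    exact iInf_mono fun y => add_le_add le_rfl (max_le (hpp y) (EReal.coe_ennreal_nonneg _))
  refine le_trans ?_ (hmax v hvc fun x => ⟨hv0 x, hvv₀ x⟩)
  have hint := hvc.integrable_profit hc hc0 hcd f hv0
  by_cases hF : Integrable (fun x => (sSup (p '' TpE c p x)).toReal) f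
  · exact integral_mono hF hint (toReal_sSup_image_TpE_le hc hc0 hcd hpt hv)
  · rw [Fincome, integral_undef hF]
    exact integral_nonneg fun x =>
      sub_nonneg.2 (sInf_cost_csuperdiff_le_self hc0 hcd (hvc.bddAbove hc hc0) hv0 x)
end
end

section
/- Suppose the cost is the distance of the compact metric space Q, i.e. c(x,y) = d(x,y). Let p₀ : Q → [0,+∞] be proper and f a finite nonnegative Borel measure on Q. Then the function p_opt(x) := inf_{y∈Q} { p₀(y) + d(x,y) } is the largest 1-Lipschitz function on Q below p₀, it belongs to the admissible class 𝒜, F(p_opt) = ∫_Q p_opt df, and p_opt maximizes F over 𝒜: F(p) ≤ F(p_opt) for every p ∈ 𝒜. -/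
open Filter Set MeasureTheory
open scoped ENNReal

noncomputable section

/-- The transform `⨅ y, (dist x y + p₀ y)` is finite whenever `p₀` is proper. -/
theorem coe_toReal_iInf_dist_add {Q : Type*} [PseudoMetricSpace Q] {p₀ : Q → ℝ≥0∞}
    (hp₀ : ∃ y, p₀ y ≠ ⊤) (x : Q) :
    (((⨅ y, ((dist x y : EReal) + (p₀ y : EReal))).toReal : ℝ) : EReal) =
      ⨅ y, ((dist x y : EReal) + (p₀ y : EReal)) := by
  obtain ⟨y, hy⟩ := hp₀
  refine EReal.coe_toReal (ne_top_of_le_ne_top ?_ (iInf_le _ y)) (ne_bot_of_le_ne_bot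
    EReal.zero_ne_bot (le_iInf fun z => add_nonneg (mod_cast dist_nonneg)
      (EReal.coe_ennreal_nonneg _)))
  lift p₀ y to NNReal using hy with r
  exact EReal.coe_ne_top (dist x y + r)

/-- A real number lies below `dist x y + p₀ y` for all `y` as soon as it does so where `p₀` is
finite. -/
theorem coe_le_iInf_dist_add_iff {Q : Type*} [PseudoMetricSpace Q] {p₀ : Q → ℝ≥0∞}
    {a : ℝ} {x : Q} :
    (a : EReal) ≤ ⨅ y, ((dist x y : EReal) + (p₀ y : EReal)) ↔
      ∀ y, p₀ y ≠ ⊤ → a ≤ dist x y + (p₀ y).toReal := by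
  refine le_iInf_iff.trans (forall_congr' fun y => ?_)
  rcases eq_or_ne (p₀ y) ⊤ with h | h
  · simp [h]
  · have h' : (p₀ y : EReal) = ((p₀ y).toReal : ℝ) := by
      rw [← EReal.toReal_coe_ennreal, EReal.coe_toReal] <;> simp [h]
    rw [h', ← EReal.coe_add, EReal.coe_le_coe_iff]
    simp [h]

/-- A price paid at an optimal location never exceeds the minimal total expenditure. -/
theorem sSup_image_TpE_le_vpE {Q : Type*} [PseudoMetricSpace Q] (p : Q → EReal) (x : Q) :
    sSup (p '' TpE (fun x y => dist x y) p x) ≤ vpE (fun x y => dist x y) p x := by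
  refine sSup_le ?_
  rintro _ ⟨y, hy, rfl⟩
  rw [← show _ = vpE _ p x from hy]
  exact le_add_of_nonneg_left (mod_cast dist_nonneg)

/-- For a `1`-Lipschitz price, buying at home is optimal. -/
theorem sSup_image_TpE_of_lipschitz {Q : Type*} [PseudoMetricSpace Q] {g : Q → ℝ}
    (hg : LipschitzWith 1 g) (x : Q) :
    sSup ((fun y => (g y : EReal)) '' TpE (fun x y => dist x y) (fun y => (g y : EReal)) x) =
      g x := by
  have hv : vpE (fun x y => dist x y) (fun y => (g y : EReal)) x = g x := by
    refine le_antisymm ((iInf_le _ x).trans (by simp)) (le_iInf fun y => ?_)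
    rw [← EReal.coe_add, EReal.coe_le_coe_iff, add_comm]
    simpa using hg.le_add_mul x y
  refine le_antisymm ((sSup_image_TpE_le_vpE _ x).trans_eq hv) (le_sSup ⟨x, ?_, rfl⟩)
  simp [TpE, hv]

/-- When the cost is the distance, `p_opt(x) = inf_y (p₀ y + d(x,y))` is the largest
`1`-Lipschitz function below `p₀`; it is admissible, `F(p_opt) = ∫ p_opt df`, and it
maximizes `F` over the admissible class `𝒜`. -/
theorem optimal_price_distance_cost
    {Q : Type*} [MetricSpace Q] [CompactSpace Q] [Nonempty Q]
    [MeasurableSpace Q] [BorelSpace Q]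
    (p₀ : Q → ℝ≥0∞) (hp₀ : ∃ y, p₀ y ≠ ⊤)
    (f : Measure Q) [IsFiniteMeasure f]
    (popt : Q → ℝ)
    (hpopt : ∀ x, popt x = (⨅ y, ((dist x y : EReal) + (p₀ y : EReal))).toReal) :
    (LipschitzWith 1 popt ∧ (∀ x, (popt x : EReal) ≤ (p₀ x : EReal)) ∧
      (∀ g : Q → ℝ, LipschitzWith 1 g → (∀ x, (g x : EReal) ≤ (p₀ x : EReal)) →
        ∀ x, g x ≤ popt x)) ∧
    LowerSemicontinuous (fun x => ((popt x : ℝ) : EReal)) ∧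
    Fincome f (fun x y => dist x y) (fun x => ((popt x : ℝ) : EReal)) = ∫ x, popt x ∂f ∧
    ∀ p : Q → EReal, LowerSemicontinuous p → (∀ y, p y ≠ ⊥) → (∃ y, p y ≠ ⊤) →
      (∀ y, p y ≤ (p₀ y : EReal)) →
      Fincome f (fun x y => dist x y) p ≤
        Fincome f (fun x y => dist x y) (fun x => ((popt x : ℝ) : EReal)) := by
  have hcoe (x : Q) : (popt x : EReal) = ⨅ y, ((dist x y : EReal) + (p₀ y : EReal)) := by
    rw [hpopt x, coe_toReal_iInf_dist_add hp₀ x]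
  have hle (a : ℝ) (x : Q) :
      a ≤ popt x ↔ ∀ y, p₀ y ≠ ⊤ → a ≤ dist x y + (p₀ y).toReal := by
    rw [← coe_le_iInf_dist_add_iff, ← hcoe, EReal.coe_le_coe_iff]
  have hnn (x : Q) : 0 ≤ popt x :=
    (hle 0 x).2 fun y _ => add_nonneg dist_nonneg ENNReal.toReal_nonneg
  have hlip : LipschitzWith 1 popt := by
    refine LipschitzWith.of_le_add fun x x' => ?_
    rw [← sub_le_iff_le_add]
    refine (hle _ _).2 fun y hy => ?_
    have h₁ := (hle _ x).1 le_rfl y hy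
    have h₂ := dist_triangle x x' y
    linarith
  have hF : Fincome f (fun x y => dist x y) (fun x => ((popt x : ℝ) : EReal)) =
      ∫ x, popt x ∂f :=
    integral_congr_ae (.of_forall fun x => by
      simp only [sSup_image_TpE_of_lipschitz hlip x, EReal.toReal_coe])
  refine ⟨⟨hlip, fun x => ?_, fun g hg hgp x => ?_⟩, ?_, hF, fun p _ _ _ hp => ?_⟩
  · rw [hcoe]
    exact (iInf_le _ x).trans (by simp)
  · rw [← EReal.coe_le_coe_iff, hcoe]
    refine le_iInf fun y => ?_
    refine le_trans ?_ (add_le_add_right (hgp y) _)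
    rw [← EReal.coe_add, EReal.coe_le_coe_iff, add_comm]
    simpa using hg.le_add_mul x y
  · exact (continuous_coe_real_ereal.comp hlip.continuous).lowerSemicontinuous
  · rw [hF, Fincome]
    by_cases hint : Integrable
        (fun x => (sSup (p '' TpE (fun x y => dist x y) p x)).toReal) f
    · have hpint : Integrable popt f :=
        hlip.continuous.integrable_of_hasCompactSupport (HasCompactSupport.of_compactSpace popt)
      refine integral_mono hint hpint fun x => ?_
      have h : sSup (p '' TpE (fun x y => dist x y) p x) ≤ (popt x : EReal) := by
        refine (sSup_image_TpE_le_vpE p x).trans ?_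
        rw [hcoe]
        exact iInf_mono fun y => add_le_add_right (hp y) _
      rcases eq_or_ne (sSup (p '' TpE (fun x y => dist x y) p x)) ⊥ with hb | hb
      · simpa only [hb, EReal.toReal_bot] using hnn x
      · exact EReal.toReal_le_toReal h hb (EReal.coe_ne_top _)
    · rw [integral_undef hint]
      exact integral_nonneg hnn
end
end

section
/- Let Ω be an open bounded subset of ℝ^N, Q = closure of Ω, h : ℝ^N → ℝ a nonnegative C¹ strictly convex function, and c(x,y) = h(x − y). Let v : Q → ℝ be c-concave. Then at every point x ∈ Ω where v is (Fréchet) differentiable, every y ∈ ∂^c v(x) satisfies ∇v(x) = ∇h(x − y); consequently, by strict convexity of h (which makes ∇h injective), ∂^c v(x) is a singleton at every such point, and hence ∂^c v is single-valued Lebesgue-almost everywhere on Ω. -/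
open Filter Set MeasureTheory
open scoped ENNReal

noncomputable section

/-- A function `v` is `c`-concave on `Q` if there is `u` upper semicontinuous on
`Q` such that `v x = inf_{y ∈ Q} (c x y - u y)` for every `x ∈ Q`. -/
def CConcaveOn {E : Type*} [TopologicalSpace E] (c : E → E → ℝ) (Q : Set E)
    (v : E → ℝ) : Prop :=
  ∃ u : E → ℝ, UpperSemicontinuousOn u Q ∧
    ∀ x ∈ Q, v x = sInf ((fun y => c x y - u y) '' Q)

/-- The `c`-transform relative to `Q`: `v^c(y) = inf_{x ∈ Q} (c x y - v x)`. -/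
def ctransformOn {E : Type*} (c : E → E → ℝ) (Q : Set E) (v : E → ℝ) (y : E) : ℝ :=
  sInf ((fun x => c x y - v x) '' Q)

/-- The `c`-superdifferential relative to `Q`:
`∂^c v(x) = { y ∈ Q : v x + v^c y = c x y }`. -/
def csuperdiffOn {E : Type*} (c : E → E → ℝ) (Q : Set E) (v : E → ℝ) (x : E) :
    Set E :=
  {y ∈ Q | v x + ctransformOn c Q v y = c x y}

/-- The Fréchet derivative of a differentiable strictly convex function is injective. -/
theorem StrictConvexOn.fderiv_injective {E : Type*} [NormedAddCommGroup E] [NormedSpace ℝ E]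
    {h : E → ℝ} (hh : StrictConvexOn ℝ univ h) (hd : Differentiable ℝ h) :
    Function.Injective (fderiv ℝ h) := by
  intro a b hab
  by_contra hne
  have hline : StrictConvexOn ℝ univ (h ∘ AffineMap.lineMap (k := ℝ) a b) := by
    refine ⟨convex_univ, fun s _ t _ hst p q hp hq hpq => ?_⟩
    have hlt := hh.2 (mem_univ (AffineMap.lineMap (k := ℝ) a b s))
      (mem_univ (AffineMap.lineMap (k := ℝ) a b t))
      (fun he => hst (AffineMap.lineMap_injective ℝ hne he)) hp hq hpq
    simpa only [Function.comp_apply, Convex.combo_affine_apply hpq] using hlt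
  have hderiv (t : ℝ) : HasDerivAt (h ∘ AffineMap.lineMap (k := ℝ) a b)
      (fderiv ℝ h (AffineMap.lineMap a b t) (b - a)) t :=
    (hd _).hasFDerivAt.comp_hasDerivAt t AffineMap.hasDerivAt_lineMap
  have h0 := hline.lt_slope_of_hasDerivAt (mem_univ 0) (mem_univ 1) one_pos (hderiv 0)
  have h1 := hline.slope_lt_of_hasDerivAt (mem_univ 0) (mem_univ 1) one_pos (hderiv 1)
  rw [AffineMap.lineMap_apply_zero, hab] at h0
  rw [AffineMap.lineMap_apply_one] at h1
  exact lt_irrefl _ (h0.trans h1)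

theorem exists_eq_sub_and_le_of_sInf {E : Type*} [TopologicalSpace E] {c : E → E → ℝ}
    {Q : Set E} {u v : E → ℝ} (hQ : IsCompact Q) (hne : Q.Nonempty)
    (hc : ∀ x ∈ Q, ContinuousOn (c x) Q) (hu : UpperSemicontinuousOn u Q)
    (hv : ∀ x ∈ Q, v x = sInf ((fun y => c x y - u y) '' Q)) {x : E} (hx : x ∈ Q) :
    (∃ y ∈ Q, v x = c x y - u y) ∧ ∀ y ∈ Q, v x ≤ c x y - u y := by
  obtain ⟨y₀, hy₀, hmax⟩ := UpperSemicontinuousOn.exists_isMaxOn hne hQ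
    (hu.add (hc x hx).neg.upperSemicontinuousOn)
  have hleast : IsLeast ((fun y => c x y - u y) '' Q) (c x y₀ - u y₀) := by
    refine ⟨mem_image_of_mem _ hy₀, ?_⟩
    rintro _ ⟨y, hy, rfl⟩
    have := isMaxOn_iff.1 hmax y hy
    simp only [Pi.neg_apply] at this
    dsimp only
    linarith
  have hvx : v x = c x y₀ - u y₀ := (hv x hx).trans hleast.csInf_eq
  exact ⟨⟨y₀, hy₀, hvx⟩, fun y hy => hvx.trans_le (hleast.2 (mem_image_of_mem _ hy))⟩

/-- A `c`-concave function on a compact set lies below `c(·, y) - v^c(y)`. -/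
theorem CConcaveOn.add_ctransformOn_le {E : Type*} [TopologicalSpace E] {c : E → E → ℝ}
    {Q : Set E} {v : E → ℝ} (hv : CConcaveOn c Q v) (hQ : IsCompact Q)
    (hc : ∀ x ∈ Q, ContinuousOn (c x) Q) {x y : E} (hx : x ∈ Q) (hy : y ∈ Q) :
    v x + ctransformOn c Q v y ≤ c x y := by
  obtain ⟨u, hu, huv⟩ := hv
  have hbdd : BddBelow ((fun x => c x y - v x) '' Q) := by
    refine ⟨u y, ?_⟩
    rintro _ ⟨z, hz, rfl⟩
    have := (exists_eq_sub_and_le_of_sInf hQ ⟨x, hx⟩ hc hu huv hz).2 y hy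
    dsimp only
    linarith
  have : ctransformOn c Q v y ≤ c x y - v x := csInf_le hbdd ⟨x, hx, rfl⟩
  linarith

/-- The `c`-superdifferential of a `c`-concave function on a compact set is nonempty. -/
theorem CConcaveOn.csuperdiffOn_nonempty {E : Type*} [TopologicalSpace E] {c : E → E → ℝ}
    {Q : Set E} {v : E → ℝ} (hv : CConcaveOn c Q v) (hQ : IsCompact Q)
    (hc : ∀ x ∈ Q, ContinuousOn (c x) Q) {x : E} (hx : x ∈ Q) :
    (csuperdiffOn c Q v x).Nonempty := by
  have hv' := hv
  obtain ⟨u, hu, huv⟩ := hv'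
  obtain ⟨y, hy, hxy⟩ := (exists_eq_sub_and_le_of_sInf hQ ⟨x, hx⟩ hc hu huv hx).1
  refine ⟨y, hy, le_antisymm (hv.add_ctransformOn_le hQ hc hx hy) ?_⟩
  have : u y ≤ ctransformOn c Q v y := by
    refine le_csInf (image_nonempty.2 ⟨x, hx⟩) ?_
    rintro _ ⟨z, hz, rfl⟩
    have := (exists_eq_sub_and_le_of_sInf hQ ⟨x, hx⟩ hc hu huv hz).2 y hy
    dsimp only
    linarith
  linarith

/-- A `c`-concave function for a locally Lipschitz translation-invariant cost is Lipschitz on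
compact sets. -/
theorem CConcaveOn.exists_lipschitzOnWith {E : Type*} [NormedAddCommGroup E]
    {h : E → ℝ} {Q : Set E} {v : E → ℝ} (hv : CConcaveOn (fun x y => h (x - y)) Q v)
    (hQ : IsCompact Q) (hh : LocallyLipschitz h) : ∃ K, LipschitzOnWith K v Q := by
  obtain ⟨K, hK⟩ := hh.locallyLipschitzOn.exists_lipschitzOnWith_of_compact 
    ((hQ.prod hQ).image continuous_sub)
  have hc : ∀ x ∈ Q, ContinuousOn (fun y => h (x - y)) Q := fun x _ =>
    (hh.continuous.comp (continuous_const.sub continuous_id)).continuousOn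
  obtain ⟨u, hu, huv⟩ := hv
  refine ⟨K, LipschitzOnWith.of_le_add_mul K fun x hx z hz => ?_⟩
  obtain ⟨y, hy, hzy⟩ := (exists_eq_sub_and_le_of_sInf hQ ⟨x, hx⟩ hc hu huv hz).1
  have hxy := (exists_eq_sub_and_le_of_sInf hQ ⟨x, hx⟩ hc hu huv hx).2 y hy
  have hlip := hK.le_add_mul (mem_image_of_mem _ (mk_mem_prod hx hy))
    (mem_image_of_mem _ (mk_mem_prod hz hy))
  dsimp only at hlip
  rw [dist_sub_right] at hlip
  linarith

theorem fderiv_eq_of_mem_csuperdiffOn {E : Type*} [NormedAddCommGroup E] [NormedSpace ℝ E]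
    {h : E → ℝ} {Q : Set E} {v : E → ℝ} (hv : CConcaveOn (fun x y => h (x - y)) Q v)
    (hQ : IsCompact Q) (hh : Differentiable ℝ h) {x y : E} (hx : Q ∈ nhds x)
    (hvx : DifferentiableAt ℝ v x) (hy : y ∈ csuperdiffOn (fun x y => h (x - y)) Q v x) :
    fderiv ℝ v x = fderiv ℝ h (x - y) := by
  have hc : ∀ x ∈ Q, ContinuousOn (fun y => h (x - y)) Q := fun x _ =>
    (hh.continuous.comp (continuous_const.sub continuous_id)).continuousOn
  have hmin : IsLocalMin (fun z => h (z - y) - v z) x := by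
    filter_upwards [hx] with z hz
    have h1 := hv.add_ctransformOn_le hQ hc hz hy.1
    have h2 := hy.2
    dsimp only at h1 h2
    linarith
  have hd : HasFDerivAt (fun z => h (z - y) - v z) (fderiv ℝ h (x - y) - fderiv ℝ v x) x :=
    ((hasFDerivAt_comp_sub y).2 (hh (x - y)).hasFDerivAt).sub hvx.hasFDerivAt
  exact (sub_eq_zero.1 (hmin.hasFDerivAt_eq_zero hd)).symm

/-- For a strictly convex smooth cost `c(x,y) = h(x-y)`, at every differentiability
point `x ∈ Ω` of a `c`-concave function `v`, every `y ∈ ∂^c v(x)` satisfies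
`∇v(x) = ∇h(x-y)`; hence `∂^c v(x)` is a singleton there, and `∂^c v` is
single-valued Lebesgue-almost everywhere on `Ω`. -/
theorem csuperdiff_singleton_of_strictly_convex_cost
    {N : ℕ} (Ω : Set (EuclideanSpace ℝ (Fin N)))
    (hΩo : IsOpen Ω) (hΩb : Bornology.IsBounded Ω)
    (h : EuclideanSpace ℝ (Fin N) → ℝ)
    (hh0 : ∀ z, 0 ≤ h z) (hh1 : ContDiff ℝ 1 h)
    (hhsc : StrictConvexOn ℝ univ h)
    (v : EuclideanSpace ℝ (Fin N) → ℝ)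
    (hv : CConcaveOn (fun x y => h (x - y)) (closure Ω) v) :
    (∀ x ∈ Ω, DifferentiableAt ℝ v x →
      (∀ y ∈ csuperdiffOn (fun x y => h (x - y)) (closure Ω) v x,
        gradient v x = gradient h (x - y)) ∧
      ∃ y, csuperdiffOn (fun x y => h (x - y)) (closure Ω) v x = {y}) ∧
    ∀ᵐ x ∂(volume : Measure (EuclideanSpace ℝ (Fin N))), x ∈ Ω →
      ∃ y, csuperdiffOn (fun x y => h (x - y)) (closure Ω) v x = {y} := by
  have hQ : IsCompact (closure Ω) := hΩb.isCompact_closure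
  have hd : Differentiable ℝ h := hh1.differentiable one_ne_zero
  have hc : ∀ x ∈ closure Ω, ContinuousOn (fun y => h (x - y)) (closure Ω) := fun x _ =>
    (hd.continuous.comp (continuous_const.sub continuous_id)).continuousOn
  have hnhds {x} (hx : x ∈ Ω) : closure Ω ∈ nhds x :=
    mem_of_superset (hΩo.mem_nhds hx) subset_closure
  have hsingle : ∀ x ∈ Ω, DifferentiableAt ℝ v x →
      ∃ y, csuperdiffOn (fun x y => h (x - y)) (closure Ω) v x = {y} := by
    intro x hx hvx
    obtain ⟨y, hy⟩ := hv.csuperdiffOn_nonempty hQ hc (subset_closure hx)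
    refine ⟨y, eq_singleton_iff_unique_mem.2 ⟨hy, fun z hz => ?_⟩⟩
    have hyz : x - z = x - y := hhsc.fderiv_injective hd <|
      (fderiv_eq_of_mem_csuperdiffOn hv hQ hd (hnhds hx) hvx hz).symm.trans
        (fderiv_eq_of_mem_csuperdiffOn hv hQ hd (hnhds hx) hvx hy)
    exact sub_right_injective hyz
  refine ⟨fun x hx hvx => ⟨fun y hy => ?_, hsingle x hx hvx⟩, ?_⟩
  · rw [gradient, gradient, fderiv_eq_of_mem_csuperdiffOn hv hQ hd (hnhds hx) hvx hy]
  · obtain ⟨K, hK⟩ := hv.exists_lipschitzOnWith hQ hh1.locallyLipschitz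
    filter_upwards [hK.ae_differentiableWithinAt_of_mem (μ := volume)] with x hx hxΩ
    exact hsingle x hxΩ ((hx (subset_closure hxΩ)).differentiableAt (hnhds hxΩ))
end
end

section
/- In the second (subregion) model, the profit does not decrease when prices are truncated at zero: if p ∈ 𝒜 then p₊ := max(p, 0) also belongs to 𝒜 and Π(p₊) ≥ Π(p). -/
open Filter Set MeasureTheory

noncomputable section

/-- The minimal total expenditure `v_p(x) = min_y (c x y + p y)`. -/
def vprice {Q : Type*} (c : Q → Q → ℝ) (p : Q → ℝ) (x : Q) : ℝ :=
  ⨅ y, (c x y + p y)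

/-- The set `T_p(x)` of optimal shopping locations for a customer living at `x`. -/
def Tprice {Q : Type*} (c : Q → Q → ℝ) (p : Q → ℝ) (x : Q) : Set Q :=
  {y | c x y + p y = vprice c p x}

/-- The set `Ω₁(p)` of customers that may rationally shop in the free region `Q₁`. -/
def Omega1 {Q : Type*} (c : Q → Q → ℝ) (p : Q → ℝ) (Q₁ : Set Q) : Set Q :=
  {x | (Tprice c p x ∩ Q₁).Nonempty}

/-- The profit `Π(p) = ∫_{Ω₁(p)} (max_{y ∈ T_p(x) ∩ Q₁} p y) df(x)`. -/
def Profit {Q : Type*} [MeasurableSpace Q] (f : Measure Q) (c : Q → Q → ℝ)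
    (p : Q → ℝ) (Q₁ : Set Q) : ℝ :=
  ∫ x in Omega1 c p Q₁, sSup (p '' (Tprice c p x ∩ Q₁)) ∂f

theorem isClosed_setOf_add_price_le {X Y : Type*} [TopologicalSpace X]
    [TopologicalSpace Y] {p : Y → ℝ} (hp : LowerSemicontinuous p) {π : X → Y}
    (hπ : Continuous π) {a b : X → ℝ} (ha : Continuous a) (hb : Continuous b) :
    IsClosed {w | a w + p (π w) ≤ b w} := by
  have h : LowerSemicontinuous fun w => p (π w) + (a w - b w) :=
    (hp.comp hπ).add (ha.sub hb).lowerSemicontinuous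
  convert h.isClosed_preimage 0 using 1
  ext w
  simp only [mem_ofPred_eq, mem_preimage, mem_Iic]
  constructor <;> intro h <;> linarith

section

variable {Q : Type*} [MetricSpace Q] [CompactSpace Q] {c : Q → Q → ℝ} {p : Q → ℝ} {Q₁ : Set Q}

theorem bddBelow_range_add_price (hc0 : ∀ x y, 0 ≤ c x y) (hp : LowerSemicontinuous p) (x : Q) :
    BddBelow (range fun y => c x y + p y) := by
  obtain ⟨m, hm⟩ := (hp.lowerSemicontinuousOn univ).bddBelow_of_isCompact isCompact_univ
  refine ⟨m, ?_⟩
  rintro _ ⟨y, rfl⟩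
  exact (hm ⟨y, mem_univ y, rfl⟩).trans (le_add_of_nonneg_left (hc0 x y))

theorem mem_Tprice_iff (hc0 : ∀ x y, 0 ≤ c x y) (hp : LowerSemicontinuous p) {x y : Q} :
    y ∈ Tprice c p x ↔ ∀ z, c x y + p y ≤ c x z + p z := by
  have : Nonempty Q := ⟨x⟩
  have hb := bddBelow_range_add_price hc0 hp x
  refine ⟨fun h z => ?_, fun h => le_antisymm (le_ciInf h) (ciInf_le hb y)⟩
  exact (show c x y + p y = vprice c p x from h).trans_le (ciInf_le hb z)

/-- The pairs of a customer `x` and an optimal location `y ∈ Q₁` with price at least `t` form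
a closed set. -/
theorem isClosed_setOf_le_price (hc : Continuous fun z : Q × Q => c z.1 z.2)
    (hc0 : ∀ x y, 0 ≤ c x y) (hp : LowerSemicontinuous p) (hQ₁ : IsClosed Q₁) (t : ℝ) :
    IsClosed {w : Q × Q | w.2 ∈ Tprice c p w.1 ∩ Q₁ ∧ t ≤ p w.2} := by
  have hz : ∀ z, Continuous fun w : Q × Q => c w.1 z := fun z =>
    hc.comp (continuous_fst.prodMk continuous_const)
  have h₁ : IsClosed (⋂ z, {w : Q × Q | c w.1 w.2 + p w.2 ≤ c w.1 z + p z}) :=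
    isClosed_iInter fun z => isClosed_setOf_add_price_le hp continuous_snd hc
      ((hz z).add continuous_const)
  have h₂ : IsClosed (⋂ z, {w : Q × Q | t + c w.1 w.2 ≤ c w.1 z + p z}) :=
    isClosed_iInter fun z => isClosed_le (continuous_const.add hc) ((hz z).add continuous_const)
  convert (h₁.inter h₂).inter (hQ₁.preimage continuous_snd) using 1
  ext ⟨x, y⟩
  simp only [mem_ofPred_eq, mem_inter_iff, mem_iInter, mem_preimage, mem_Tprice_iff hc0 hp]
  constructor
  · rintro ⟨⟨h, hy⟩, ht⟩
    exact ⟨⟨h, fun z => by linarith [h z]⟩, hy⟩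
  · rintro ⟨⟨h, h'⟩, hy⟩
    exact ⟨⟨h, hy⟩, by linarith [h' y]⟩

theorem isClosed_Tprice_inter (hc : Continuous fun z : Q × Q => c z.1 z.2)
    (hc0 : ∀ x y, 0 ≤ c x y) (hp : LowerSemicontinuous p) (hQ₁ : IsClosed Q₁) (x : Q) :
    IsClosed (Tprice c p x ∩ Q₁) := by
  have hx : Continuous (c x) := hc.comp (continuous_const.prodMk continuous_id)
  have h : IsClosed (⋂ z, {y | c x y + p y ≤ c x z + p z}) :=
    isClosed_iInter fun z => isClosed_setOf_add_price_le hp continuous_id hx continuous_const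
  convert h.inter hQ₁ using 2
  ext y
  simp only [mem_iInter, mem_ofPred_eq, mem_Tprice_iff hc0 hp]

theorem isCompact_image_Tprice_inter (hc : Continuous fun z : Q × Q => c z.1 z.2)
    (hc0 : ∀ x y, 0 ≤ c x y) (hp : LowerSemicontinuous p) (hQ₁ : IsClosed Q₁) (x : Q) :
    IsCompact (p '' (Tprice c p x ∩ Q₁)) := by
  have hx : Continuous (c x) := hc.comp (continuous_const.prodMk continuous_id)
  refine (isClosed_Tprice_inter hc hc0 hp hQ₁ x).isCompact.image_of_continuousOn ?_
  refine (continuous_const.sub hx : Continuous fun y => vprice c p x - c x y).continuousOn.congr ?_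
  rintro y ⟨hy, -⟩
  exact eq_sub_of_add_eq' hy

/-- Customers in `Ω₁(p)` whose highest optimal price is at least `t` form a closed set. -/
theorem isClosed_setOf_le_sSup_price (hc : Continuous fun z : Q × Q => c z.1 z.2)
    (hc0 : ∀ x y, 0 ≤ c x y) (hp : LowerSemicontinuous p) (hQ₁ : IsClosed Q₁) (t : ℝ) :
    IsClosed {x | x ∈ Omega1 c p Q₁ ∧ t ≤ sSup (p '' (Tprice c p x ∩ Q₁))} := by
  convert isClosedMap_fst_of_compactSpace _ (isClosed_setOf_le_price hc hc0 hp hQ₁ t) using 1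
  ext x
  simp only [mem_ofPred_eq, mem_image, Prod.exists, exists_and_right, exists_eq_right]
  have hK := isCompact_image_Tprice_inter hc hc0 hp hQ₁ x
  constructor
  · rintro ⟨hx, ht⟩
    obtain ⟨y, hy, hyp⟩ := hK.sSup_mem (hx.image p)
    exact ⟨y, hy, hyp ▸ ht⟩
  · rintro ⟨y, hy, ht⟩
    exact ⟨⟨y, hy⟩, ht.trans (le_csSup hK.bddAbove (mem_image_of_mem p hy))⟩

theorem isClosed_Omega1 (hc : Continuous fun z : Q × Q => c z.1 z.2)
    (hc0 : ∀ x y, 0 ≤ c x y) (hp : LowerSemicontinuous p) (hQ₁ : IsClosed Q₁) :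
    IsClosed (Omega1 c p Q₁) := by
  obtain ⟨m, hm⟩ := (hp.lowerSemicontinuousOn univ).bddBelow_of_isCompact isCompact_univ
  convert isClosed_setOf_le_sSup_price hc hc0 hp hQ₁ m using 1
  ext x
  refine ⟨fun hx => ⟨hx, ?_⟩, And.left⟩
  obtain ⟨y, hy⟩ := hx
  exact (hm ⟨y, mem_univ y, rfl⟩).trans
    (le_csSup (isCompact_image_Tprice_inter hc hc0 hp hQ₁ x).bddAbove (mem_image_of_mem p hy))

theorem integrable_indicator_sSup_price [MeasurableSpace Q] [BorelSpace Q] (f : Measure Q)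
    [IsFiniteMeasure f] (hc : Continuous fun z : Q × Q => c z.1 z.2) (hc0 : ∀ x y, 0 ≤ c x y)
    (hp : LowerSemicontinuous p) (hQ₁ : IsClosed Q₁) (hp0 : ∀ x, 0 ≤ p x) :
    Integrable ((Omega1 c p Q₁).indicator fun x => sSup (p '' (Tprice c p x ∩ Q₁))) f := by
  set h := (Omega1 c p Q₁).indicator fun x => sSup (p '' (Tprice c p x ∩ Q₁)) with hh
  have h0 : ∀ x, 0 ≤ h x := indicator_nonneg fun x _ =>
    Real.sSup_nonneg (by rintro _ ⟨y, -, rfl⟩; exact hp0 y)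
  have hmeas : Measurable h := by
    refine measurable_of_Ici fun t => ?_
    rcases le_or_gt t 0 with ht | ht
    · convert MeasurableSet.univ using 1
      exact eq_univ_of_forall fun x => ht.trans (h0 x)
    · convert (isClosed_setOf_le_sSup_price hc hc0 hp hQ₁ t).measurableSet using 1
      ext x
      by_cases hx : x ∈ Omega1 c p Q₁ <;> simp [hh, hx, ht]
  rcases isEmpty_or_nonempty Q with hQ | ⟨⟨y₀⟩⟩
  · exact ⟨hmeas.aestronglyMeasurable, by simp [HasFiniteIntegral, Measure.eq_zero_of_isEmpty f]⟩
  have hy₀ : Continuous fun x => c x y₀ := hc.comp (continuous_id.prodMk continuous_const)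
  obtain ⟨C, hC⟩ := (isCompact_range hy₀).bddAbove
  have hC' : ∀ x, c x y₀ ≤ C := fun x => hC (mem_range_self x)
  refine Integrable.of_bound hmeas.aestronglyMeasurable (C + p y₀) (ae_of_all _ fun x => ?_)
  have hCp : 0 ≤ C + p y₀ := add_nonneg ((hc0 y₀ y₀).trans (hC' y₀)) (hp0 y₀)
  rw [Real.norm_of_nonneg (h0 x)]
  refine indicator_le' (g := fun _ => C + p y₀) (fun x _ => ?_) (fun _ _ => hCp) x
  refine Real.sSup_le ?_ hCp
  rintro _ ⟨y, ⟨hy, -⟩, rfl⟩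
  linarith [(mem_Tprice_iff hc0 hp).1 hy y₀, hc0 x y, hC' x]

theorem mem_Tprice_posPart (hc0 : ∀ x y, 0 ≤ c x y) (hp : LowerSemicontinuous p)
    (hp' : LowerSemicontinuous fun x => max (p x) 0) {x y : Q} (hy : y ∈ Tprice c p x)
    (hpy : 0 ≤ p y) : y ∈ Tprice c (fun x => max (p x) 0) x := by
  refine (mem_Tprice_iff hc0 hp').2 fun z => ?_
  rw [max_eq_left hpy]
  exact ((mem_Tprice_iff hc0 hp).1 hy z).trans (add_le_add_right (le_max_left _ _) _)

end

/-- In the subregion model, truncating prices at zero is admissible and does not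
decrease the profit: if `p ∈ 𝒜` then `p₊ = max(p,0) ∈ 𝒜` and `Π(p₊) ≥ Π(p)`. -/
theorem profit_le_profit_posPart
    {Q : Type*} [MetricSpace Q] [CompactSpace Q] [Nonempty Q]
    [MeasurableSpace Q] [BorelSpace Q]
    (Q₀ : Set Q) (hQ₀ : IsOpen Q₀) (hQ₁ : Q₀ᶜ.Nonempty)
    (c : Q → Q → ℝ) (hc : Continuous fun z : Q × Q => c z.1 z.2)
    (hc0 : ∀ x y, 0 ≤ c x y) (hcd : ∀ x, c x x = 0)
    (p₀ : Q → ℝ) (hp₀lsc : LowerSemicontinuousOn p₀ Q₀) (hp₀0 : ∀ x ∈ Q₀, 0 ≤ p₀ x)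
    (f : Measure Q) [IsFiniteMeasure f]
    (p : Q → ℝ) (hplsc : LowerSemicontinuous p) (hpQ₀ : ∀ x ∈ Q₀, p x = p₀ x) :
    (LowerSemicontinuous (fun x => max (p x) 0) ∧
      ∀ x ∈ Q₀, max (p x) 0 = p₀ x) ∧
    Profit f c p Q₀ᶜ ≤ Profit f c (fun x => max (p x) 0) Q₀ᶜ := by
  have hp' : LowerSemicontinuous fun x => max (p x) 0 := hplsc.sup lowerSemicontinuous_const
  refine ⟨⟨hp', fun x hx => by rw [hpQ₀ x hx, max_eq_left (hp₀0 x hx)]⟩, ?_⟩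
  have hQc : IsClosed Q₀ᶜ := hQ₀.isClosed_compl
  have hint := integrable_indicator_sSup_price f hc hc0 hp' hQc fun x => le_max_right _ _
  have h0 : ∀ x, 0 ≤ (Omega1 c (fun x => max (p x) 0) Q₀ᶜ).indicator
      (fun x => sSup ((fun x => max (p x) 0) '' (Tprice c (fun x => max (p x) 0) x ∩ Q₀ᶜ))) x :=
    indicator_nonneg fun x _ =>
      Real.sSup_nonneg (by rintro _ ⟨y, -, rfl⟩; exact le_max_right _ _)
  unfold Profit
  rw [← integral_indicator (isClosed_Omega1 hc hc0 hplsc hQc).measurableSet,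
    ← integral_indicator (isClosed_Omega1 hc hc0 hp' hQc).measurableSet]
  by_cases hi : Integrable ((Omega1 c p Q₀ᶜ).indicator
      fun x => sSup (p '' (Tprice c p x ∩ Q₀ᶜ))) f
  swap
  · rw [integral_undef hi]
    exact integral_nonneg h0
  refine integral_mono hi hint fun x => ?_
  by_cases hx : x ∈ Omega1 c p Q₀ᶜ
  swap
  · rw [indicator_of_notMem hx]
    exact h0 x
  rw [indicator_of_mem hx]
  obtain ⟨y, hy, hyp⟩ :=
    (isCompact_image_Tprice_inter hc hc0 hplsc hQc x).sSup_mem (hx.image p)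
  rw [← hyp]
  rcases le_or_gt (p y) 0 with hpy | hpy
  · exact hpy.trans (h0 x)
  have hy' := mem_Tprice_posPart hc0 hplsc hp' hy.1 hpy.le
  rw [indicator_of_mem (show x ∈ Omega1 c (fun x => max (p x) 0) Q₀ᶜ from ⟨y, hy', hy.2⟩)]
  exact (le_max_left _ _).trans
    (le_csSup (isCompact_image_Tprice_inter hc hc0 hp' hQc x).bddAbove
      (mem_image_of_mem (fun x => max (p x) 0) ⟨hy', hy.2⟩))
end
end

section
/- Let Ω be a bounded open convex subset of ℝ^d, Q = closure of Ω, c(x,y) = ‖x − y‖ the Euclidean distance, Q₀ an open subset of Q with Q₀ ≠ Q, and Q₁ = Q \ Q₀. If w : Q → ℝ is (Q₁,c)-concave, then for every x ∈ Q₀ one has w(x) = min_{y ∈ ∂Q₀} { ‖x − y‖ + w(y) }, where ∂Q₀ denotes the (relative) boundary of Q₀ in Q. -/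
open Filter Set

noncomputable section

/-- A function `w` is `(Q₁,c)`-concave relative to `Q` if
`w x = inf_{y ∈ Q₁} (c x y - u y)` for every `x ∈ Q`, for some `u` bounded above
on `Q₁`. -/
def QcConcaveOn {E : Type*} (c : E → E → ℝ) (Q Q₁ : Set E) (w : E → ℝ) : Prop :=
  ∃ u : E → ℝ, BddAbove (u '' Q₁) ∧
    ∀ x ∈ Q, w x = sInf ((fun y => c x y - u y) '' Q₁)

section Eikonal

variable {E : Type*} [NormedAddCommGroup E] {Q Q₁ : Set E} {u w : E → ℝ}

/-- The family defining the eikonal transform of a function bounded above is bounded below. -/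
lemma bddBelow_image_norm_sub_sub (hu : BddAbove (u '' Q₁)) (x : E) :
    BddBelow ((fun y => ‖x - y‖ - u y) '' Q₁) := by
  obtain ⟨M, hM⟩ := hu
  refine ⟨-M, ?_⟩
  rintro _ ⟨y, hy, rfl⟩
  have h1 := hM (mem_image_of_mem u hy)
  have h2 := norm_nonneg (x - y)
  simp only
  linarith

/-- A `(Q₁,c)`-concave function for the norm cost is `1`-Lipschitz. -/
lemma QcConcaveOn.le_norm_sub_add (hw : QcConcaveOn (fun x y => ‖x - y‖) Q Q₁ w)
    (hne : Q₁.Nonempty) {x y : E} (hx : x ∈ Q) (hy : y ∈ Q) :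
    w x ≤ ‖x - y‖ + w y := by
  obtain ⟨u, hu, hwu⟩ := hw
  suffices w x - ‖x - y‖ ≤ w y by linarith
  rw [hwu y hy]
  refine le_csInf (hne.image _) ?_
  rintro _ ⟨z, hz, rfl⟩
  have h1 : w x ≤ ‖x - z‖ - u z :=
    hwu x hx ▸ csInf_le (bddBelow_image_norm_sub_sub hu x) (mem_image_of_mem _ hz)
  have h2 := norm_sub_le_norm_sub_add_norm_sub x y z
  simp only
  linarith

lemma QcConcaveOn.continuousOn (hw : QcConcaveOn (fun x y => ‖x - y‖) Q Q₁ w)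
    (hne : Q₁.Nonempty) : ContinuousOn w Q :=
  (LipschitzOnWith.of_le_add fun x hx y hy => by
    simpa [dist_eq_norm, add_comm] using hw.le_norm_sub_add hne hx hy).continuousOn

/-- If `Q₁` is compact, a `(Q₁,c)`-concave function for the norm cost is determined by
its values on `Q₁`, with the infimum attained. -/
lemma QcConcaveOn.exists_norm_sub_add_le (hw : QcConcaveOn (fun x y => ‖x - y‖) Q Q₁ w)
    (hne : Q₁.Nonempty) (hcomp : IsCompact Q₁) (hsub : Q₁ ⊆ Q) {x : E} (hx : x ∈ Q) :
    ∃ y ∈ Q₁, ‖x - y‖ + w y ≤ w x := by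
  have hcont : ContinuousOn (fun y => ‖x - y‖ + w y) Q₁ :=
    (by fun_prop : Continuous fun y => ‖x - y‖).continuousOn.add
      ((hw.continuousOn hne).mono hsub)
  obtain ⟨y, hy, hmin⟩ := hcomp.exists_isMinOn hne hcont
  refine ⟨y, hy, ?_⟩
  obtain ⟨u, hu, hwu⟩ := hw
  rw [hwu x hx]
  refine le_csInf (hne.image _) ?_
  rintro _ ⟨z, hz, rfl⟩
  have h1 : w z ≤ ‖z - z‖ - u z :=
    hwu z (hsub hz) ▸ csInf_le (bddBelow_image_norm_sub_sub hu z) (mem_image_of_mem _ hz)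
  have h2 : ‖x - y‖ + w y ≤ ‖x - z‖ + w z := hmin hz
  rw [sub_self, norm_zero] at h1
  simp only
  linarith

end Eikonal

/-- A segment in `Q` joining `Q₀` to `Q \ Q₀` meets the boundary of `Q₀` relative to `Q`. -/
lemma exists_mem_segment_closure_inter_closure_diff {E : Type*} [NormedAddCommGroup E]
    [NormedSpace ℝ E] {Q Q₀ : Set E} (hQ : Convex ℝ Q) {x y : E} (hx : x ∈ Q₀)
    (hxQ : x ∈ Q) (hy : y ∈ Q \ Q₀) :
    ∃ z ∈ segment ℝ x y, z ∈ closure Q₀ ∩ closure (Q \ Q₀) := by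
  refine isPreconnected_closed_iff.1 (convex_segment x y).isPreconnected _ _
    isClosed_closure isClosed_closure (fun z hz => ?_)
    ⟨x, left_mem_segment ℝ x y, subset_closure hx⟩
    ⟨y, right_mem_segment ℝ x y, subset_closure hy⟩
  by_cases h : z ∈ Q₀
  · exact Or.inl (subset_closure h)
  · exact Or.inr (subset_closure ⟨hQ.segment_subset hxQ hy.1 hz, h⟩)

/-- In the eikonal case (`c` the Euclidean distance on the closure `Q` of a convex
bounded open set), every `(Q₁,c)`-concave function satisfies
`w(x) = min_{y ∈ ∂Q₀} (‖x - y‖ + w y)` for every `x ∈ Q₀`, where `∂Q₀` is the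
boundary of `Q₀` relative to `Q`. -/
theorem QcConcave_boundary_representation
    {d : ℕ} (Ω : Set (EuclideanSpace ℝ (Fin d)))
    (hΩo : IsOpen Ω) (hΩb : Bornology.IsBounded Ω) (hΩc : Convex ℝ Ω)
    (Q₀ : Set (EuclideanSpace ℝ (Fin d)))
    (hQ₀sub : Q₀ ⊆ closure Ω)
    (hQ₀open : ∃ U : Set (EuclideanSpace ℝ (Fin d)), IsOpen U ∧ Q₀ = U ∩ closure Ω)
    (hQ₀ne : Q₀ ≠ closure Ω)
    (w : EuclideanSpace ℝ (Fin d) → ℝ)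
    (hw : QcConcaveOn (fun x y => ‖x - y‖) (closure Ω) (closure Ω \ Q₀) w) :
    ∀ x ∈ Q₀,
      IsLeast ((fun y => ‖x - y‖ + w y) ''
        (closure Q₀ ∩ closure (closure Ω \ Q₀))) (w x) := by
  intro x hx
  have hne : (closure Ω \ Q₀).Nonempty :=
    sdiff_nonempty.2 fun h => hQ₀ne (hQ₀sub.antisymm h)
  have hcomp : IsCompact (closure Ω \ Q₀) := by
    obtain ⟨U, hU, rfl⟩ := hQ₀open
    rw [sdiff_inter_self_eq_sdiff]
    exact hΩb.isCompact_closure.diff hU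
  have hxQ := hQ₀sub hx
  have hbdry : closure Q₀ ∩ closure (closure Ω \ Q₀) ⊆ closure Ω := fun z hz =>
    closure_minimal hQ₀sub isClosed_closure hz.1
  obtain ⟨y, hy, hxy⟩ := hw.exists_norm_sub_add_le hne hcomp sdiff_subset hxQ
  obtain ⟨z, hz, hzb⟩ := exists_mem_segment_closure_inter_closure_diff hΩc.closure hx hxQ hy
  refine ⟨⟨z, hzb, le_antisymm ?_ (hw.le_norm_sub_add hne hxQ (hbdry hzb))⟩, ?_⟩
  · have h1 := dist_add_dist_of_mem_segment hz
    simp only [dist_eq_norm] at h1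
    have h2 := hw.le_norm_sub_add hne (hbdry hzb) hy.1
    simp only
    linarith
  · rintro _ ⟨v, hv, rfl⟩
    exact hw.le_norm_sub_add hne hxQ (hbdry hv)
end
end

section
/- Let Ω be a bounded open convex subset of ℝ^d, Q = closure of Ω, c(x,y) = ‖x − y‖, Q₀ an open subset of Q, and Q₁ = Q \ Q₀ nonempty. If w : Q → ℝ is (Q₁,c)-concave, then at every point x ∈ Q₀ ∩ Ω where w is (Fréchet) differentiable one has ‖∇w(x)‖ = 1 and ∇w(x) ∈ ℝ₊(x − Q₁), i.e. there exist λ > 0 such that x − λ∇w(x) ∈ Q₁. In particular, since w is 1-Lipschitz, these conditions hold Lebesgue-almost everywhere on Q₀ ∩ Ω. -/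
open Filter Set MeasureTheory

noncomputable section

section Eikonal

variable {E : Type*}

/-- A `(Q₁,c)`-concave function for the norm cost is `1`-Lipschitz. -/
theorem QcConcaveOn.lipschitzOnWith [NormedAddCommGroup E] {Q Q₁ : Set E} {w : E → ℝ}
    (hw : QcConcaveOn (fun x y => ‖x - y‖) Q Q₁ w) (hne : Q₁.Nonempty) :
    LipschitzOnWith 1 w Q := by
  obtain ⟨u, ⟨M, hM⟩, hw⟩ := hw
  refine LipschitzOnWith.of_le_add fun x hx z hz => ?_
  rw [hw x hx, hw z hz, ← sub_le_iff_le_add]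
  refine le_csInf (hne.image _) ?_
  rintro _ ⟨y, hy, rfl⟩
  have hbdd : BddBelow ((fun y => ‖x - y‖ - u y) '' Q₁) := by
    refine ⟨-M, ?_⟩
    rintro _ ⟨y, hy, rfl⟩
    have := hM (mem_image_of_mem u hy)
    have := norm_nonneg (x - y)
    dsimp only
    linarith
  have h := csInf_le hbdd (mem_image_of_mem _ hy)
  have htri := norm_sub_le_norm_sub_add_norm_sub x z y
  rw [dist_eq_norm]
  dsimp only at h ⊢
  linarith

/-- If `Q₁` is compact, the infimum in `w x = inf_{y ∈ Q₁} (‖x - y‖ + w y)` is attained. -/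
theorem QcConcaveOn.exists_eq_norm_sub_add [NormedAddCommGroup E] {Q Q₁ : Set E} {w : E → ℝ}
    (hw : QcConcaveOn (fun x y => ‖x - y‖) Q Q₁ w) (hsub : Q₁ ⊆ Q) (hQ₁ : IsCompact Q₁)
    (hne : Q₁.Nonempty) {x : E} (hx : x ∈ Q) :
    ∃ y ∈ Q₁, w x = ‖x - y‖ + w y := by
  have hlip := hw.lipschitzOnWith hne
  have hcont : ContinuousOn (fun y => ‖x - y‖ + w y) Q₁ :=
    (by fun_prop : Continuous fun y => ‖x - y‖).continuousOn.add (hlip.continuousOn.mono hsub)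
  obtain ⟨y, hy, hmin⟩ := hQ₁.exists_isMinOn hne hcont
  refine ⟨y, hy, le_antisymm ?_ ?_⟩
  · have := hlip.le_add_mul hx (hsub hy)
    rw [dist_eq_norm, NNReal.coe_one, one_mul] at this
    linarith
  · obtain ⟨u, ⟨M, hM⟩, hw⟩ := hw
    rw [hw x hx]
    refine le_csInf (hne.image _) ?_
    rintro _ ⟨z, hz, rfl⟩
    have hmz := isMinOn_iff.1 hmin z hz
    have hwz : w z ≤ -u z := by
      rw [hw z (hsub hz)]
      refine csInf_le ⟨-M, ?_⟩ ⟨z, hz, by simp⟩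
      rintro _ ⟨y, hy, rfl⟩
      have := hM (mem_image_of_mem u hy)
      have := norm_nonneg (z - y)
      dsimp only
      linarith
    dsimp only at hmz ⊢
    linarith

/-- If a `1`-Lipschitz function satisfies `w x = ‖x - y‖ + w y` with `x ≠ y` and is
differentiable at `x`, then its gradient at `x` is the unit vector pointing from `y` to `x`. -/
theorem norm_gradient_eq_one_of_eq_norm_sub_add [NormedAddCommGroup E] [InnerProductSpace ℝ E]
    [CompleteSpace E] {Q : Set E} {w : E → ℝ} {x y : E} (hQ : Q ∈ nhds x)
    (hlip : LipschitzOnWith 1 w Q) (hdiff : DifferentiableAt ℝ w x) (hy : y ∈ Q)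
    (hne : x ≠ y) (hxy : w x = ‖x - y‖ + w y) :
    ‖gradient w x‖ = 1 ∧ x - ‖x - y‖ • gradient w x = y := by
  have hr : 0 < ‖x - y‖ := norm_pos_iff.2 (sub_ne_zero.2 hne)
  set r := ‖x - y‖ with hr_def
  set v := r⁻¹ • (x - y) with hv_def
  have hrv : r • v = x - y := smul_inv_smul₀ hr.ne' _
  have hv : ‖v‖ = 1 := by
    rw [hv_def, norm_smul, norm_inv, Real.norm_of_nonneg hr.le, ← hr_def, inv_mul_cancel₀ hr.ne']
  have hnorm : ‖gradient w x‖ ≤ 1 := by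
    rw [gradient, LinearIsometryEquiv.norm_map]
    exact norm_fderiv_le_of_lipschitzOn ℝ hQ hlip
  have hinner : 1 ≤ inner ℝ (gradient w x) v := by
    rw [gradient, InnerProductSpace.toDual_symm_apply]
    have hderiv := (hdiff.hasFDerivAt.hasLineDerivAt (-v)).tendsto_slope_zero_right
    have hpath : Tendsto (fun t : ℝ => x + t • -v) (nhdsWithin 0 (Ioi 0)) (nhds x) := by
      have : Continuous fun t : ℝ => x + t • -v := by fun_prop
      simpa using (this.tendsto 0).mono_left nhdsWithin_le_nhds
    have hle : fderiv ℝ w x (-v) ≤ -1 := by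
      refine le_of_tendsto hderiv ?_
      filter_upwards [hpath hQ, Ioo_mem_nhdsGT hr] with t htQ ht
      have h := hlip.le_add_mul htQ hy
      have hd : x + t • -v - y = (r - t) • v := by
        rw [sub_smul, hrv]
        module
      rw [dist_eq_norm, hd, norm_smul, hv, Real.norm_of_nonneg (sub_nonneg.2 ht.2.le),
        NNReal.coe_one] at h
      rw [smul_eq_mul, inv_mul_le_iff₀ ht.1]
      linarith
    rw [map_neg] at hle
    linarith
  have hgv : gradient w x = v := by
    rw [← sub_eq_zero, ← norm_eq_zero]
    have := norm_sub_sq_real (gradient w x) v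
    rw [hv] at this
    have := norm_nonneg (gradient w x)
    nlinarith [norm_nonneg (gradient w x - v)]
  rw [hgv, hrv, sub_sub_cancel]
  exact ⟨hv, rfl⟩

end Eikonal

/-- In the eikonal case, a `(Q₁,c)`-concave function `w` satisfies, at every point
`x ∈ Q₀ ∩ Ω` of differentiability, `‖∇w(x)‖ = 1` and `∇w(x) ∈ ℝ₊ (x - Q₁)`;
in particular these conditions hold Lebesgue-a.e. on `Q₀ ∩ Ω`. -/
theorem QcConcave_eikonal_gradient
    {d : ℕ} (Ω : Set (EuclideanSpace ℝ (Fin d)))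
    (hΩo : IsOpen Ω) (hΩb : Bornology.IsBounded Ω) (hΩc : Convex ℝ Ω)
    (Q₀ : Set (EuclideanSpace ℝ (Fin d)))
    (hQ₀sub : Q₀ ⊆ closure Ω)
    (hQ₀open : ∃ U : Set (EuclideanSpace ℝ (Fin d)), IsOpen U ∧ Q₀ = U ∩ closure Ω)
    (hQ₁ne : (closure Ω \ Q₀).Nonempty)
    (w : EuclideanSpace ℝ (Fin d) → ℝ)
    (hw : QcConcaveOn (fun x y => ‖x - y‖) (closure Ω) (closure Ω \ Q₀) w) :
    (∀ x ∈ Q₀ ∩ Ω, DifferentiableAt ℝ w x →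
      ‖gradient w x‖ = 1 ∧
        ∃ l : ℝ, 0 < l ∧ x - l • gradient w x ∈ closure Ω \ Q₀) ∧
    ∀ᵐ x ∂(volume : Measure (EuclideanSpace ℝ (Fin d))), x ∈ Q₀ ∩ Ω →
      DifferentiableAt ℝ w x ∧ ‖gradient w x‖ = 1 ∧
        ∃ l : ℝ, 0 < l ∧ x - l • gradient w x ∈ closure Ω \ Q₀ := by
  obtain ⟨U, hUo, rfl⟩ := hQ₀open
  have hQ₁ : IsCompact (closure Ω \ (U ∩ closure Ω)) := by
    rw [sdiff_inter_self_eq_sdiff]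
    exact hΩb.isCompact_closure.diff hUo
  have hlip := hw.lipschitzOnWith hQ₁ne
  have hpt : ∀ x ∈ U ∩ closure Ω ∩ Ω, DifferentiableAt ℝ w x → ‖gradient w x‖ = 1 ∧
      ∃ l : ℝ, 0 < l ∧ x - l • gradient w x ∈ closure Ω \ (U ∩ closure Ω) := by
    rintro x ⟨hxU, hxΩ⟩ hdiff
    obtain ⟨y, hy, hxy⟩ := hw.exists_eq_norm_sub_add sdiff_subset hQ₁ hQ₁ne hxU.2
    have hne : x ≠ y := by
      rintro rfl
      exact hy.2 hxU
    obtain ⟨h1, h2⟩ := norm_gradient_eq_one_of_eq_norm_sub_add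
      (mem_of_superset (hΩo.mem_nhds hxΩ) subset_closure) hlip hdiff hy.1 hne hxy
    refine ⟨h1, ‖x - y‖, norm_pos_iff.2 (sub_ne_zero.2 hne), ?_⟩
    rw [h2]
    exact hy
  refine ⟨hpt, ?_⟩
  filter_upwards [(hlip.mono subset_closure).ae_differentiableWithinAt_of_mem (μ := volume)]
    with x hx hxQ
  have hd := (hx hxQ.2).differentiableAt (hΩo.mem_nhds hxQ.2)
  exact ⟨hd, hpt x hxQ hd⟩
end
end

section
/- Let p₀ > 0 and, for real numbers p₁, p₂, set s₁ = p₀ − p₁, s₂ = p₂ − p₀ + 1, s₀ = (p₂ − p₁ + 1)/2, and F(t) = max(0, min(t, 1)). Consider the profit function G(p₁,p₂) = p₁ · F(min(s₀, s₁)) + p₂ · (1 − F(max(s₀, s₂))) on the constraint set { (p₁,p₂) : 0 ≤ p₁ ≤ p₀, 0 ≤ p₂ ≤ p₀, |p₂ − p₁| ≤ 1 }. Then G attains its maximum on this set at the unique point p₁ = p₂ = max(p₀/2, p₀ − 1/2). -/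
noncomputable section

/-- The uniform cumulative distribution function on `[0,1]`. -/
def cdfUnif (t : ℝ) : ℝ := max 0 (min t 1)

/-- The profit of the agent choosing boundary prices `p₁` (at `0`) and `p₂` (at `1`)
in the one-dimensional subregion model with `Q = [0,1]`, `Q₀ = (0,1)`, constant
fixed price `p₀` and uniform customers:
`G(p₁,p₂) = p₁ F(min(s₀,s₁)) + p₂ (1 - F(max(s₀,s₂)))` with `s₁ = p₀ - p₁`,
`s₂ = p₂ - p₀ + 1`, `s₀ = (p₂ - p₁ + 1)/2`. -/
def boundaryProfit (p₀ p₁ p₂ : ℝ) : ℝ :=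
  p₁ * cdfUnif (min ((p₂ - p₁ + 1) / 2) (p₀ - p₁)) +
    p₂ * (1 - cdfUnif (max ((p₂ - p₁ + 1) / 2) (p₂ - p₀ + 1)))

/-- On `[0,1]` the uniform cumulative distribution function is the identity. -/
lemma cdfUnif_of_mem {t : ℝ} (h₀ : 0 ≤ t) (h₁ : t ≤ 1) : cdfUnif t = t := by
  rw [cdfUnif, min_eq_left h₁, max_eq_right h₀]

/-- On the constraint set the profit is the revenue from two market shares, each bounded by
competition with the other end and with the fixed price. -/
lemma boundaryProfit_eq {p₀ p₁ p₂ : ℝ} (h₁ : p₁ ≤ p₀) (h₂ : p₂ ≤ p₀) (h : |p₂ - p₁| ≤ 1) :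
    boundaryProfit p₀ p₁ p₂ =
      p₁ * min ((p₂ - p₁ + 1) / 2) (p₀ - p₁) + p₂ * min ((p₁ - p₂ + 1) / 2) (p₀ - p₂) := by
  obtain ⟨hl, hu⟩ := abs_le.mp h
  have hmax : 1 - max ((p₂ - p₁ + 1) / 2) (p₂ - p₀ + 1) =
      min ((p₁ - p₂ + 1) / 2) (p₀ - p₂) := by
    rw [← min_sub_sub_left]
    congr 1 <;> ring
  rw [boundaryProfit, cdfUnif_of_mem (le_min (by linarith) (by linarith))
      (min_le_of_left_le (by linarith)),
    cdfUnif_of_mem (le_max_of_le_left (by linarith)) (max_le (by linarith) (by linarith)), hmax]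

/-- For equal prices the profit is `2 p · min (1/2) (p₀ - p)`. -/
lemma boundaryProfit_diag {p₀ p : ℝ} (h : p ≤ p₀) :
    boundaryProfit p₀ p p = 2 * (p * min (1 / 2) (p₀ - p)) := by
  rw [boundaryProfit_eq h h (by simp)]
  simp only [sub_self, zero_add]
  ring

/-- The profit `G` attains its maximum on the constraint set
`{0 ≤ p₁ ≤ p₀, 0 ≤ p₂ ≤ p₀, |p₂ - p₁| ≤ 1}` at the unique point
`p₁ = p₂ = max (p₀/2) (p₀ - 1/2)`. -/
theorem boundaryProfit_max_unique (p₀ : ℝ) (hp₀ : 0 < p₀) :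
    (0 ≤ max (p₀ / 2) (p₀ - 1 / 2) ∧ max (p₀ / 2) (p₀ - 1 / 2) ≤ p₀ ∧
      |max (p₀ / 2) (p₀ - 1 / 2) - max (p₀ / 2) (p₀ - 1 / 2)| ≤ 1) ∧
    ∀ p₁ p₂ : ℝ, 0 ≤ p₁ → p₁ ≤ p₀ → 0 ≤ p₂ → p₂ ≤ p₀ → |p₂ - p₁| ≤ 1 →
      boundaryProfit p₀ p₁ p₂ ≤
        boundaryProfit p₀ (max (p₀ / 2) (p₀ - 1 / 2)) (max (p₀ / 2) (p₀ - 1 / 2)) ∧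
      (boundaryProfit p₀ p₁ p₂ =
          boundaryProfit p₀ (max (p₀ / 2) (p₀ - 1 / 2)) (max (p₀ / 2) (p₀ - 1 / 2)) →
        p₁ = max (p₀ / 2) (p₀ - 1 / 2) ∧ p₂ = max (p₀ / 2) (p₀ - 1 / 2)) := by
  have hm : max (p₀ / 2) (p₀ - 1 / 2) ≤ p₀ := max_le (by linarith) (by linarith)
  refine ⟨⟨le_max_of_le_left (by linarith), hm, by simp⟩, ?_⟩
  intro p₁ p₂ h₁ h₁' h₂ h₂' h
  rw [boundaryProfit_diag hm, boundaryProfit_eq h₁' h₂' h]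
  have ha := min_le_left ((p₂ - p₁ + 1) / 2) (p₀ - p₁)
  have ha' := min_le_right ((p₂ - p₁ + 1) / 2) (p₀ - p₁)
  have hb := min_le_left ((p₁ - p₂ + 1) / 2) (p₀ - p₂)
  have hb' := min_le_right ((p₁ - p₂ + 1) / 2) (p₀ - p₂)
  obtain ⟨hl, hu⟩ := abs_le.mp h
  have ha₀ : 0 ≤ min ((p₂ - p₁ + 1) / 2) (p₀ - p₁) := le_min (by linarith) (by linarith)
  have hb₀ : 0 ≤ min ((p₁ - p₂ + 1) / 2) (p₀ - p₂) := le_min (by linarith) (by linarith)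
  generalize min ((p₂ - p₁ + 1) / 2) (p₀ - p₁) = a at *
  generalize min ((p₁ - p₂ + 1) / 2) (p₀ - p₂) = b at *
  rcases le_total p₀ 1 with hp | hp
  · rw [max_eq_left (by linarith), min_eq_right (by linarith)]
    have hA := mul_le_mul_of_nonneg_left ha' h₁
    have hB := mul_le_mul_of_nonneg_left hb' h₂
    refine ⟨by nlinarith [sq_nonneg (p₁ - p₀ / 2), sq_nonneg (p₂ - p₀ / 2)], fun he => ?_⟩
    have hsq₁ : (p₁ - p₀ / 2) ^ 2 = 0 :=
      le_antisymm (by nlinarith [sq_nonneg (p₂ - p₀ / 2)]) (sq_nonneg _)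
    have hsq₂ : (p₂ - p₀ / 2) ^ 2 = 0 :=
      le_antisymm (by nlinarith [sq_nonneg (p₁ - p₀ / 2)]) (sq_nonneg _)
    exact ⟨sub_eq_zero.mp (pow_eq_zero_iff two_ne_zero |>.mp hsq₁),
      sub_eq_zero.mp (pow_eq_zero_iff two_ne_zero |>.mp hsq₂)⟩
  · rw [max_eq_right (by linarith), min_eq_left (by linarith)]
    have hA := mul_le_mul_of_nonneg_right (le_sub_comm.mp ha') ha₀
    have hB := mul_le_mul_of_nonneg_right (le_sub_comm.mp hb') hb₀
    have hS : 0 ≤ (p₀ - 1) * (1 - (a + b)) := mul_nonneg (by linarith) (by linarith)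
    have key : p₁ * a + p₂ * b + (a - 1 / 2) ^ 2 + (b - 1 / 2) ^ 2 ≤
        2 * ((p₀ - 1 / 2) * (1 / 2)) := by linarith
    refine ⟨by linarith [sq_nonneg (a - 1 / 2), sq_nonneg (b - 1 / 2)], fun he => ?_⟩
    have hsq₁ : (a - 1 / 2) ^ 2 = 0 :=
      le_antisymm (by linarith [sq_nonneg (b - 1 / 2)]) (sq_nonneg _)
    have hsq₂ : (b - 1 / 2) ^ 2 = 0 :=
      le_antisymm (by linarith [sq_nonneg (a - 1 / 2)]) (sq_nonneg _)
    obtain rfl : a = 1 / 2 := sub_eq_zero.mp (pow_eq_zero_iff two_ne_zero |>.mp hsq₁)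
    obtain rfl : b = 1 / 2 := sub_eq_zero.mp (pow_eq_zero_iff two_ne_zero |>.mp hsq₂)
    constructor <;> linarith
end
end
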